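/- arXiv:1602.01981 — 5 statements merged into one kernel-verified Lean document; each statement's English description precedes it below -/
import Mathlib

section
/- Let R be a commutative Noetherian ring, I an ideal of R, and M a finitely generated R-module. Then there exists N such that for all n ≥ N, the set of associated primes Ass_R(M/I^n M) equals Ass_R(M/I^N M); i.e., Ass_R(M/I^n M) is independent of n for all sufficiently large n. -/
open Submodule in
/-- Over a Noetherian `R`-algebra `S`, if the annihilator of an element of an `S`-module contracts
to a prime `p` of `R`, then `p` is the contraction of an associated prime over `S`. -/
theorem exists_mem_associatedPrimes_comap_eq {R S E : Type*} [CommRing R] [CommRing S]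
    [Algebra R S] [IsNoetherianRing S] [AddCommGroup E] [Module S E] (p : Ideal R) [p.IsPrime]
    (x : E) (hx : (colon (⊥ : Submodule S E) {x}).comap (algebraMap R S) = p) :
    ∃ P ∈ associatedPrimes S E, P.comap (algebraMap R S) = p := by
  have mem_iff : ∀ (s : S) (y : E), s ∈ colon (⊥ : Submodule S E) {y} ↔ s • y = 0 := fun s y ↦ by
    rw [mem_colon_singleton, mem_bot]
  obtain ⟨P, ⟨⟨y, rfl⟩, hy⟩, hmax⟩ := set_has_maximal_iff_noetherian.mpr ‹IsNoetherianRing S›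
    {J : Ideal S | (∃ y : E, J = colon ⊥ {y}) ∧ J.comap (algebraMap R S) = p} ⟨_, ⟨x, rfl⟩, hx⟩
  have eq_of_le : ∀ z : E, (∀ s : S, s • y = 0 → s • z = 0) →
      (∀ r : R, algebraMap R S r • z = 0 → r ∈ p) → ∀ s : S, s • z = 0 → s • y = 0 := by
    intro z hle hz s hs
    have hle' : colon (⊥ : Submodule S E) {y} ≤ colon ⊥ {z} := fun t ht ↦
      (mem_iff t z).2 (hle t ((mem_iff t y).1 ht))
    have hzp : (colon (⊥ : Submodule S E) {z}).comap (algebraMap R S) = p :=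
      le_antisymm (fun r hr ↦ hz r ((mem_iff _ z).1 hr)) (hy ▸ Ideal.comap_mono hle')
    have hnlt := hmax _ ⟨⟨z, rfl⟩, hzp⟩
    rw [← mem_iff, eq_of_le_of_not_lt hle' hnlt, mem_iff]
    exact hs
  have hyp : ∀ r : R, algebraMap R S r • y = 0 ↔ r ∈ p := fun r ↦ by
    rw [← mem_iff, ← Ideal.mem_comap, hy]
  refine ⟨_, isAssociatedPrime_iff.2 ⟨⟨?_, ?_⟩, y, rfl⟩, hy⟩
  · intro htop
    rw [htop, Ideal.comap_top] at hy
    exact Ideal.IsPrime.ne_top ‹p.IsPrime› hy.symm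
  · intro a b hab
    rw [mem_iff] at hab
    rw [mem_iff, mem_iff]
    by_cases h : ∀ r : R, algebraMap R S r • b • y = 0 → r ∈ p
    · refine Or.inl (eq_of_le (b • y) (fun s hs ↦ ?_) h a (by rwa [smul_smul]))
      rw [smul_comm, hs, smul_zero]
    · push Not at h
      obtain ⟨r, hr, hrp⟩ := h
      refine Or.inr (eq_of_le (algebraMap R S r • y) (fun s hs ↦ ?_) (fun t ht ↦ ?_) b ?_)
      · rw [smul_comm, hs, smul_zero]
      · rw [smul_smul, ← map_mul, hyp] at ht
        exact (Ideal.IsPrime.mem_or_mem ‹_› ht).resolve_right hrp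
      · rw [smul_comm, hr]

namespace Ideal

variable {R M : Type*} [CommRing R] [AddCommGroup M] [Module R M]

/-- The primes of the form `(F (n + 1) : x)` with `x ∈ F n`, that is, the associated primes of the
`n`-th component of the graded module of the filtration `F`. -/
def Filtration.gradedAssociatedPrimes {I : Ideal R} (F : I.Filtration M) (n : ℕ) :
    Set (Ideal R) :=
  {p | p.IsPrime ∧ ∃ x ∈ F.N n, ∀ r : R, r ∈ p ↔ r • x ∈ F.N (n + 1)}

/-- The filtration `n ↦ F (n + 1)`. -/
def Filtration.shift {I : Ideal R} (F : I.Filtration M) : I.Filtration M where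
  N n := F.N (n + 1)
  mono n := F.mono (n + 1)
  smul_le n := F.smul_le (n + 1)

theorem Filtration.Stable.finite_iUnion_gradedAssociatedPrimes [IsNoetherianRing R]
    [Module.Finite R M] {I : Ideal R} {F : I.Filtration M} (hF : F.Stable) :
    (⋃ n, F.gradedAssociatedPrimes n).Finite := by
  have hfg : F.submodule.FG :=
    (F.submodule_fg_iff_stable fun i ↦ IsNoetherian.noetherian _).2 hF
  let E := F.submodule.map F.shift.submodule.mkQ
  have : Module.Finite (reesAlgebra I) E := Module.Finite.iff_fg.2 (hfg.map _)
  refine ((associatedPrimes.finite (reesAlgebra I) E).image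
    (Ideal.comap (algebraMap R (reesAlgebra I)))).subset ?_
  rintro p hp
  obtain ⟨n, hp, x, hx, hxp⟩ := Set.mem_iUnion.1 hp
  have single_mem : ∀ (G : I.Filtration M) (y : M),
      PolynomialModule.single R n y ∈ G.submodule ↔ y ∈ G.N n := by
    intro G y
    rw [Filtration.mem_submodule]
    refine ⟨fun h ↦ by simpa using h n, fun h i ↦ ?_⟩
    rw [PolynomialModule.coeff_single, Finsupp.single_apply]
    split_ifs with hi
    · exact hi ▸ h
    · exact zero_mem _
  let e : E := ⟨F.shift.submodule.mkQ (PolynomialModule.single R n x),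
    Submodule.mem_map_of_mem ((single_mem F x).2 hx)⟩
  refine exists_mem_associatedPrimes_comap_eq p e ?_
  ext r
  have hsmul : algebraMap R (reesAlgebra I) r • PolynomialModule.single R n x =
      PolynomialModule.single R n (r • x) := by
    rw [Subalgebra.smul_def]
    exact (PolynomialModule.monomial_smul_single 0 r n x).trans (by rw [zero_add])
  rw [Ideal.mem_comap, Submodule.mem_colon_singleton, Submodule.mem_bot, ← Subtype.coe_inj,
    Submodule.coe_smul, Submodule.coe_zero, ← map_smul, hsmul, Submodule.mkQ_apply,
    Submodule.Quotient.mk_eq_zero, single_mem, hxp]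
  rfl

/-- For a filtration `F` and an ideal `p`, the filtration of the `x ∈ F n` with
`p • x ⊆ F (n + 1)`. -/
def Filtration.gradedTorsion {I : Ideal R} (F : I.Filtration M) (p : Ideal R) :
    I.Filtration M where
  N n :=
    { carrier := {x | x ∈ F.N n ∧ ∀ r ∈ p, r • x ∈ F.N (n + 1)}
      add_mem' := fun ha hb ↦ ⟨add_mem ha.1 hb.1, fun r hr ↦ by
        rw [smul_add]
        exact add_mem (ha.2 r hr) (hb.2 r hr)⟩
      zero_mem' := ⟨zero_mem _, fun r _ ↦ by rw [smul_zero]; exact zero_mem _⟩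
      smul_mem' := fun c x hx ↦ ⟨Submodule.smul_mem _ c hx.1, fun r hr ↦ by
        rw [smul_comm]
        exact Submodule.smul_mem _ c (hx.2 r hr)⟩ }
  mono n x hx := ⟨F.mono n hx.1, fun r _ ↦ Submodule.smul_mem _ r hx.1⟩
  smul_le n := Submodule.smul_le.2 fun a ha x hx ↦
    ⟨F.smul_le n (Submodule.smul_mem_smul ha hx.1), fun r hr ↦ by
      rw [smul_comm]
      exact F.smul_le (n + 1) (Submodule.smul_mem_smul ha (hx.2 r hr))⟩

open Filter in
theorem Filtration.Stable.eventually_mem_gradedAssociatedPrimes_or_notMem [IsNoetherianRing R]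
    [Module.Finite R M] {I : Ideal R} {F : I.Filtration M} (hF : F.Stable) (p : Ideal R) :
    (∀ᶠ n in atTop, p ∈ F.gradedAssociatedPrimes n) ∨
      ∀ᶠ n in atTop, p ∉ F.gradedAssociatedPrimes n := by
  by_cases hp : p.IsPrime
  swap
  · exact Or.inr (Eventually.of_forall fun n h ↦ hp h.1)
  have hle : F.gradedTorsion p ≤ F := fun n x hx ↦ hx.1
  obtain ⟨d, hd⟩ := hF.of_le hle
  have hstep : ∀ n ≥ d, p ∉ F.gradedAssociatedPrimes n →
      p ∉ F.gradedAssociatedPrimes (n + 1) := by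
    rintro n hn hnot ⟨-, x, hx, hxp⟩
    have key : ∀ z ∈ I • (F.gradedTorsion p).N n, ∃ r ∉ p, r • z ∈ F.N (n + 2) := by
      intro z hz
      induction hz using Submodule.smul_induction_on' with
      | smul a ha y hy =>
        by_contra! hcon
        refine hnot ⟨hp, y, hy.1, fun r ↦ ⟨hy.2 r, fun hr ↦ ?_⟩⟩
        by_contra hrp
        refine hcon r hrp ?_
        rw [smul_comm]
        exact F.smul_le (n + 1) (Submodule.smul_mem_smul ha hr)
      | add y _ z _ hy hz =>
        obtain ⟨r, hr, hry⟩ := hy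
        obtain ⟨s, hs, hsz⟩ := hz
        refine ⟨r * s, fun h ↦ (hp.mem_or_mem h).elim hr hs, ?_⟩
        rw [smul_add]
        refine add_mem ?_ ?_
        · rw [mul_comm, mul_smul]
          exact Submodule.smul_mem _ s hry
        · rw [mul_smul]
          exact Submodule.smul_mem _ r hsz
    obtain ⟨r, hr, hrx⟩ := key x (by
      rw [hd n hn]
      exact ⟨hx, fun r hr ↦ (hxp r).1 hr⟩)
    exact hr ((hxp r).2 hrx)
  by_cases h : ∃ n ≥ d, p ∉ F.gradedAssociatedPrimes n
  · obtain ⟨n, hn, hpn⟩ := h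
    refine Or.inr (eventually_atTop.2 ⟨n, fun m hm ↦ ?_⟩)
    induction m, hm using Nat.le_induction with
    | base => exact hpn
    | succ m hm ih => exact hstep m (hn.trans hm) ih
  · push Not at h
    exact Or.inl (eventually_atTop.2 ⟨d, h⟩)

end Ideal

theorem Submodule.mem_associatedPrimes_quotient_iff {R M : Type*} [CommRing R]
    [IsNoetherianRing R] [AddCommGroup M] [Module R M] (N : Submodule R M) (p : Ideal R) :
    p ∈ associatedPrimes R (M ⧸ N) ↔ p.IsPrime ∧ ∃ x : M, ∀ r : R, r ∈ p ↔ r • x ∈ N := by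
  rw [AssociatedPrimes.mem_iff, isAssociatedPrime_iff, N.mkQ_surjective.exists]
  simp only [SetLike.ext_iff, mem_colon_singleton, mem_bot, mkQ_apply,
    ← Quotient.mk_smul, Quotient.mk_eq_zero]

namespace Ideal.Filtration

variable {R M : Type*} [CommRing R] [IsNoetherianRing R] [AddCommGroup M] [Module R M]
  {I : Ideal R} (F : I.Filtration M)

theorem gradedAssociatedPrimes_subset (n : ℕ) :
    F.gradedAssociatedPrimes n ⊆ associatedPrimes R (M ⧸ F.N (n + 1)) :=
  fun p ⟨hp, x, _, hx⟩ ↦ ((F.N (n + 1)).mem_associatedPrimes_quotient_iff p).2 ⟨hp, x, hx⟩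

theorem associatedPrimes_quotient_succ_subset (n : ℕ) :
    associatedPrimes R (M ⧸ F.N (n + 1)) ⊆
      associatedPrimes R (M ⧸ F.N n) ∪ F.gradedAssociatedPrimes n := by
  intro p hp
  obtain ⟨hp, x, hx⟩ := (Submodule.mem_associatedPrimes_quotient_iff _ _).1 hp
  by_cases h : ∃ r ∉ p, r • x ∈ F.N n
  · obtain ⟨r, hr, hrx⟩ := h
    refine Or.inr ⟨hp, r • x, hrx, fun s ↦ ?_⟩
    rw [smul_smul, ← hx]
    exact ⟨fun hs ↦ p.mul_mem_right r hs, fun hs ↦ (hp.mem_or_mem hs).resolve_right hr⟩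
  · push Not at h
    refine Or.inl ((Submodule.mem_associatedPrimes_quotient_iff _ _).2 ⟨hp, x, fun r ↦
      ⟨fun hr ↦ F.mono n ((hx r).1 hr), fun hr ↦ ?_⟩⟩)
    by_contra hrp
    exact h r hrp hr

variable {F} [Module.Finite R M]

open Filter in
theorem Stable.eventually_mem_associatedPrimes_quotient_or_notMem (hF : F.Stable) (p : Ideal R) :
    (∀ᶠ n in atTop, p ∈ associatedPrimes R (M ⧸ F.N n)) ∨
      ∀ᶠ n in atTop, p ∉ associatedPrimes R (M ⧸ F.N n) := by
  rcases hF.eventually_mem_gradedAssociatedPrimes_or_notMem p with h | h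
  · left
    obtain ⟨d, hd⟩ := eventually_atTop.1 h
    refine (eventually_ge_atTop (d + 1)).mono fun n hn ↦ ?_
    obtain ⟨n, rfl⟩ := Nat.exists_eq_add_of_le' (Nat.le_of_add_left_le hn)
    exact F.gradedAssociatedPrimes_subset n (hd n (by lia))
  · obtain ⟨d, hd⟩ := eventually_atTop.1 h
    by_cases h' : ∃ n ≥ d, p ∉ associatedPrimes R (M ⧸ F.N n)
    · obtain ⟨n, hn, hpn⟩ := h'
      refine Or.inr (eventually_atTop.2 ⟨n, fun m hm ↦ ?_⟩)
      induction m, hm using Nat.le_induction with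
      | base => exact hpn
      | succ m hm ih =>
        exact fun hp ↦ (F.associatedPrimes_quotient_succ_subset m hp).elim ih
          (hd m (hn.trans hm))
    · push Not at h'
      exact Or.inl (eventually_atTop.2 ⟨d, h'⟩)

theorem Stable.finite_iUnion_associatedPrimes_quotient (hF : F.Stable) :
    (⋃ n, associatedPrimes R (M ⧸ F.N n)).Finite := by
  refine ((associatedPrimes.finite R (M ⧸ F.N 0)).union
    hF.finite_iUnion_gradedAssociatedPrimes).subset (Set.iUnion_subset fun n ↦ ?_)
  induction n with
  | zero => exact Set.subset_union_left
  | succ n ih =>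
    exact (F.associatedPrimes_quotient_succ_subset n).trans (Set.union_subset ih
      ((Set.subset_iUnion _ n).trans Set.subset_union_right))

open Filter in
/-- For a stable `I`-filtration `F` of `M`, the set of associated primes of `M ⧸ F n` is
eventually constant. -/
theorem Stable.exists_associatedPrimes_quotient_eq (hF : F.Stable) :
    ∃ N : ℕ, ∀ n : ℕ, N ≤ n →
      associatedPrimes R (M ⧸ F.N n) = associatedPrimes R (M ⧸ F.N N) := by
  have hev : ∀ p : Ideal R, ∃ P : Prop,
      ∀ᶠ n in atTop, p ∈ associatedPrimes R (M ⧸ F.N n) ↔ P := fun p ↦ by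
    rcases hF.eventually_mem_associatedPrimes_quotient_or_notMem p with h | h
    · exact ⟨True, h.mono fun n hn ↦ iff_true_intro hn⟩
    · exact ⟨False, h.mono fun n hn ↦ iff_false_intro hn⟩
  choose P hP using hev
  obtain ⟨N, hN⟩ := eventually_atTop.1
    ((eventually_all_finite hF.finite_iUnion_associatedPrimes_quotient).2 fun p _ ↦ hP p)
  refine ⟨N, fun n hn ↦ Set.ext fun p ↦ ?_⟩
  by_cases hp : p ∈ ⋃ n, associatedPrimes R (M ⧸ F.N n)
  · rw [hN n hn p hp, hN N le_rfl p hp]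
  · rw [Set.mem_iUnion, not_exists] at hp
    exact iff_of_false (hp n) (hp N)

end Ideal.Filtration

/-- **Brodmann's theorem.** For a finitely generated module `M` over a commutative
Noetherian ring `R` and an ideal `I`, the set of associated primes of `M / IⁿM`
is independent of `n` for all sufficiently large `n`. -/
theorem brodmann_ass_stable (R : Type*) [CommRing R] [IsNoetherianRing R]
    (I : Ideal R) (M : Type*) [AddCommGroup M] [Module R M] [Module.Finite R M] :
    ∃ N : ℕ, ∀ n : ℕ, N ≤ n →
      associatedPrimes R (M ⧸ (I ^ n • (⊤ : Submodule R M))) =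
        associatedPrimes R (M ⧸ (I ^ N • (⊤ : Submodule R M))) := by
  exact (I.stableFiltration_stable (⊤ : Submodule R M)).exists_associatedPrimes_quotient_eq
end

section
/- Let R be a commutative Noetherian ring, I an ideal, M and N finitely generated R-modules, and fix i ≥ 0. Then the set Ass_R(Ext_R^i(M, N/I^n N)) is independent of n for all sufficiently large n. -/
open CategoryTheory

namespace Submodule

variable {R M : Type*} [CommRing R] [AddCommGroup M] [Module R M]

/-- The primes of the form `(G : b)` with `b ∈ F`. For `G ≤ F` over a Noetherian ring these are
the associated primes of `F / G`. -/
def relAssociatedPrimes (F G : Submodule R M) : Set (Ideal R) :=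
  {p | p.IsPrime ∧ ∃ b ∈ F, ∀ r, r ∈ p ↔ r • b ∈ G}

theorem relAssociatedPrimes_mono {F F' : Submodule R M} (h : F ≤ F') (G : Submodule R M) :
    relAssociatedPrimes F G ⊆ relAssociatedPrimes F' G :=
  fun _ ⟨hp, b, hb, hr⟩ ↦ ⟨hp, b, h hb, hr⟩

theorem relAssociatedPrimes_subset_union (F : Submodule R M) {E G : Submodule R M} (h : G ≤ E) :
    relAssociatedPrimes F G ⊆ relAssociatedPrimes F E ∪ relAssociatedPrimes E G := by
  rintro p ⟨hp, b, hb, hr⟩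
  by_cases hs : ∃ s ∉ p, s • b ∈ E
  · obtain ⟨s, hsp, hsE⟩ := hs
    refine .inr ⟨hp, s • b, hsE, fun r ↦ ?_⟩
    rw [smul_smul, ← hr, hp.mul_mem_iff_mem_or_mem, or_iff_left hsp]
  · push Not at hs
    exact .inl ⟨hp, b, hb, fun r ↦ ⟨fun h' ↦ h ((hr r).1 h'), fun h' ↦ by_contra (hs r · h')⟩⟩

theorem relAssociatedPrimes_eq_empty {F G : Submodule R M} (h : F ≤ G) :
    relAssociatedPrimes F G = ∅ := by
  refine Set.eq_empty_of_forall_notMem ?_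
  rintro p ⟨hp, b, hb, hr⟩
  exact hp.ne_top ((Ideal.eq_top_iff_one p).2 ((hr 1).2 (by simpa using h hb)))

/-- If `Z / ker π ≅ X` is identified, along a surjection `q`, with `F / (F ⊓ G)`, then the
associated primes of `X` can be computed from `F` and `G`. -/
theorem associatedPrimes_eq_relAssociatedPrimes [IsNoetherianRing R]
    {W X : Type*} [AddCommGroup W] [Module R W] [AddCommGroup X] [Module R X]
    {Z : Submodule R W} {π : Z →ₗ[R] X} (hπ : Function.Surjective π)
    {q : W →ₗ[R] M} (hq : Function.Surjective q) {F G : Submodule R M}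
    (hF : ∀ w, w ∈ Z ↔ q w ∈ F) (hG : ∀ w : Z, π w = 0 ↔ q w ∈ G) :
    associatedPrimes R X = relAssociatedPrimes F G := by
  ext p
  rw [AssociatedPrimes.mem_iff, isAssociatedPrime_iff]
  refine and_congr_right fun hp ↦ ⟨?_, ?_⟩
  · rintro ⟨x, rfl⟩
    obtain ⟨w, rfl⟩ := hπ x
    refine ⟨q w, (hF _).1 w.2, fun r ↦ ?_⟩
    rw [mem_colon_singleton, mem_bot, ← map_smul, hG]
    simp
  · rintro ⟨b, hb, hr⟩
    obtain ⟨w, rfl⟩ := hq b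
    refine ⟨π ⟨w, (hF w).2 hb⟩, Ideal.ext fun r ↦ ?_⟩
    rw [mem_colon_singleton, mem_bot, ← map_smul, hG, hr]
    simp

end Submodule

theorem Module.finite_setOf_isPrime_and_eq_comap_ann {R S X : Type*} [CommRing R] [CommRing S]
    [Algebra R S] [IsNoetherianRing S] [AddCommGroup X] [Module S X] [Module.Finite S X] :
    {p : Ideal R | p.IsPrime ∧ ∃ x : X, ∀ r, r ∈ p ↔ algebraMap R S r • x = 0}.Finite := by
  refine ((associatedPrimes.finite S X).image (Ideal.comap (algebraMap R S))).subset ?_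
  rintro p ⟨hp, x, hx⟩
  obtain ⟨P, ⟨y, rfl, hyp⟩, hmax⟩ := (wellFounded_gt (α := Ideal S)).has_min
    {P | ∃ y : X, P = (⊥ : Submodule S X).colon {y} ∧ P.comap (algebraMap R S) = p}
    ⟨_, x, rfl, Ideal.ext fun r ↦ by simp [hx, Submodule.mem_colon_singleton]⟩
  refine ⟨_, ?_, hyp⟩
  rw [AssociatedPrimes.mem_iff, isAssociatedPrime_iff]
  refine ⟨Ideal.isPrime_iff.2 ⟨?_, fun {s t} hst ↦ ?_⟩, y, rfl⟩
  · intro h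
    rw [h, Ideal.comap_top] at hyp
    exact hp.ne_top hyp.symm
  have hle (a : S) :
      (⊥ : Submodule S X).colon {y} ≤ (⊥ : Submodule S X).colon {a • y} := fun c hc ↦ by
    simp only [Submodule.mem_colon_singleton, Submodule.mem_bot] at hc ⊢
    rw [smul_comm, hc, smul_zero]
  simp only [Submodule.mem_colon_singleton, Submodule.mem_bot] at hst ⊢
  by_contra! hst'
  have hlt : (⊥ : Submodule S X).colon {y} < (⊥ : Submodule S X).colon {t • y} := by
    refine lt_of_le_of_ne (hle t) fun h ↦ hst'.1 ?_
    have : s ∈ (⊥ : Submodule S X).colon {t • y} := by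
      simpa [Submodule.mem_colon_singleton, smul_smul] using hst
    rw [← h] at this
    simpa [Submodule.mem_colon_singleton] using this
  have hne : ((⊥ : Submodule S X).colon {t • y}).comap (algebraMap R S) ≠ p :=
    fun h ↦ hmax _ ⟨_, rfl, h⟩ hlt
  have hle' : p ≤ ((⊥ : Submodule S X).colon {t • y}).comap (algebraMap R S) := by
    conv_lhs => rw [← hyp]
    exact Ideal.comap_mono (hle t)
  obtain ⟨r, hr, hrp⟩ := SetLike.exists_of_lt (lt_of_le_of_ne hle' hne.symm)
  have hr' : ((⊥ : Submodule S X).colon {algebraMap R S r • y}).comap (algebraMap R S) = p := by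
    ext a
    rw [Ideal.mem_comap, Submodule.mem_colon_singleton, Submodule.mem_bot, smul_smul, ← map_mul,
      ← Submodule.mem_bot S, ← Submodule.mem_colon_singleton, ← Ideal.mem_comap, hyp,
      hp.mul_mem_iff_mem_or_mem, or_iff_left hrp]
  refine hmax _ ⟨_, rfl, hr'⟩ (lt_of_le_of_ne (hle _) fun h ↦ hst'.2 ?_)
  have : t ∈ (⊥ : Submodule S X).colon {algebraMap R S r • y} := by
    simp only [Ideal.mem_comap, Submodule.mem_colon_singleton, Submodule.mem_bot] at hr ⊢
    rwa [smul_comm]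
  rw [← h] at this
  simpa [Submodule.mem_colon_singleton] using this

theorem Set.exists_forall_eq_of_subset_succ {α : Type*} {f : ℕ → Set α} {T : Set α}
    (hT : T.Finite) (hf : ∀ n, f n ⊆ T) {n₀ : ℕ} (h : ∀ n ≥ n₀, f n ⊆ f (n + 1)) :
    ∃ k, ∀ n ≥ k, f n = f k := by
  have := hT.to_subtype
  obtain ⟨k, hk⟩ := WellFoundedGT.monotone_chain_condition (α := Set T)
    ⟨fun n ↦ Subtype.val ⁻¹' f (n₀ + n), monotone_nat_of_le_succ fun n ↦
      Set.preimage_mono (h (n₀ + n) (Nat.le_add_right _ _))⟩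
  refine ⟨n₀ + k, fun n hn ↦ ?_⟩
  have := hk (n - n₀) (by lia)
  simp only [OrderHom.coe_mk, Nat.add_sub_cancel' (show n₀ ≤ n by lia)] at this
  rw [Subtype.preimage_val_eq_preimage_val_iff, inter_eq_right.2 (hf _),
    inter_eq_right.2 (hf _)] at this
  exact this.symm

namespace Ideal.Filtration

open Submodule

variable {R M : Type*} [CommRing R] [IsNoetherianRing R] {I : Ideal R} [AddCommGroup M] [Module R M]
  [Module.Finite R M]

theorem Stable.exists_finite_relAssociatedPrimes_subset {F : I.Filtration M} (hF : F.Stable)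
    (G : I.Filtration M) :
    ∃ T : Set (Ideal R), T.Finite ∧ ∀ n, relAssociatedPrimes (F.N n) (G.N n) ⊆ T := by
  have hfg : F.submodule.FG := (F.submodule_fg_iff_stable fun i ↦ IsNoetherian.noetherian _).2 hF
  have : Module.Finite (reesAlgebra I) (F.submodule.map G.submodule.mkQ) :=
    Module.Finite.iff_fg.2 (hfg.map _)
  refine ⟨_, Module.finite_setOf_isPrime_and_eq_comap_ann (R := R) (S := reesAlgebra I)
    (X := F.submodule.map G.submodule.mkQ), ?_⟩
  rintro n p ⟨hp, b, hb, hr⟩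
  have hb' : PolynomialModule.single R n b ∈ F.submodule := fun i ↦ by
    rw [PolynomialModule.coeff_single, Finsupp.single_apply]
    split_ifs with h
    · exact h ▸ hb
    · exact zero_mem _
  refine ⟨hp, ⟨_, Submodule.mem_map_of_mem hb'⟩, fun r ↦ ?_⟩
  have hs : algebraMap R (reesAlgebra I) r • PolynomialModule.single R n b =
      PolynomialModule.single R n (r • b) := by
    rw [algebraMap_smul, ← PolynomialModule.single_smul]
  rw [hr, Subtype.ext_iff, coe_smul, ← map_smul, hs, ZeroMemClass.coe_zero, mkQ_apply,
    Quotient.mk_eq_zero, mem_submodule]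
  refine ⟨fun h i ↦ ?_, fun h ↦ by simpa using h n⟩
  rw [PolynomialModule.coeff_single, Finsupp.single_apply]
  split_ifs with h'
  · exact h' ▸ h
  · exact zero_mem _

theorem Stable.exists_relAssociatedPrimes_subset_succ {F : I.Filtration M} (hF : F.Stable)
    (G : I.Filtration M) :
    ∃ n₀, ∀ n ≥ n₀, relAssociatedPrimes (F.N n) (G.N n) ⊆
      relAssociatedPrimes (F.N (n + 1)) (G.N (n + 1)) := by
  let E : I.Filtration M :=
    { N := fun n ↦ F.N n ⊓ (⨅ a : I, (G.N (n + 1)).comap (LinearMap.lsmul R M a))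
      mono := fun n ↦ inf_le_inf (F.mono n) (iInf_mono fun a ↦ Submodule.comap_mono (G.mono _))
      smul_le := fun n ↦ Submodule.smul_le.2 fun r hr x hx ↦ by
        simp only [Submodule.mem_inf, Submodule.mem_iInf, Submodule.mem_comap,
          LinearMap.lsmul_apply] at hx ⊢
        exact ⟨F.smul_le n (smul_mem_smul hr hx.1), fun a ↦
          G.smul_le _ (smul_mem_smul a.2 (hx.2 ⟨r, hr⟩))⟩ }
  obtain ⟨n₀, hn₀⟩ := hF.of_le (F' := E) fun n ↦ inf_le_left
  refine ⟨n₀ + 1, fun n hn ↦ ?_⟩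
  have hEG : E.N n ≤ G.N n := by
    obtain ⟨m, rfl⟩ : ∃ m, n = m + 1 := ⟨n - 1, by lia⟩
    rw [← hn₀ m (by lia)]
    refine Submodule.smul_le.2 fun r hr x hx ↦ ?_
    simp only [E, Submodule.mem_inf, Submodule.mem_iInf, Submodule.mem_comap,
      LinearMap.lsmul_apply] at hx
    exact hx.2 ⟨r, hr⟩
  rintro p ⟨hp, b, hb, hr⟩
  obtain ⟨s, hs⟩ := IsNoetherian.noetherian I
  have key : ∃ a ∈ s, (G.N (n + 1)).colon {a • b} ≤ p := by
    rw [← hp.inf_le']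
    intro r hrs
    simp only [mem_finsetInf, mem_colon_singleton] at hrs
    refine (hr r).2 (hEG ?_)
    simp only [E, Submodule.mem_inf, Submodule.mem_iInf, Submodule.mem_comap, LinearMap.lsmul_apply]
    refine ⟨(F.N n).smul_mem r hb, fun a ↦ ?_⟩
    have : I ≤ (G.N (n + 1)).colon {r • b} := hs.ge.trans <| Submodule.span_le.2 fun a ha ↦ by
      rw [SetLike.mem_coe, mem_colon_singleton, smul_comm]
      exact hrs a ha
    exact mem_colon_singleton.1 (this a.2)
  obtain ⟨a, ha, hle⟩ := key
  have haI : a ∈ I := hs ▸ Submodule.subset_span ha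
  refine ⟨hp, a • b, F.smul_le _ (smul_mem_smul haI hb), fun r ↦ ⟨fun h ↦ ?_, fun h ↦
    hle (mem_colon_singleton.2 h)⟩⟩
  rw [smul_comm]
  exact G.smul_le _ (smul_mem_smul haI ((hr r).1 h))

theorem Stable.exists_relAssociatedPrimes_eq {F : I.Filtration M} (hF : F.Stable)
    (G : I.Filtration M) :
    ∃ k, ∀ n ≥ k, relAssociatedPrimes (F.N n) (G.N n) = relAssociatedPrimes (F.N k) (G.N k) := by
  obtain ⟨T, hT, hsub⟩ := hF.exists_finite_relAssociatedPrimes_subset G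
  obtain ⟨n₀, hn₀⟩ := hF.exists_relAssociatedPrimes_subset_succ G
  exact Set.exists_forall_eq_of_subset_succ hT hsub hn₀

end Ideal.Filtration

namespace Ideal

open Submodule

variable {R B C : Type*} [CommRing R] [IsNoetherianRing R] (I : Ideal R)
  [AddCommGroup B] [Module R B] [AddCommGroup C] [Module R C]

/-- The filtration `n ↦ I ^ (n + d) M`. -/
def shiftedFiltration (M : Type*) [AddCommGroup M] [Module R M] (d : ℕ) : I.Filtration M where
  N n := I ^ (n + d) • ⊤
  mono n := smul_mono_left (Ideal.pow_le_pow_right (by lia))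
  smul_le n := by rw [← mul_smul, ← pow_succ', add_right_comm]

/-- The filtration `n ↦ g⁻¹(I ^ (n + d) C) ∩ I ^ n B`. -/
def comapFiltration (g : B →ₗ[R] C) (d : ℕ) : I.Filtration B where
  N n := (I ^ (n + d) • ⊤ : Submodule R C).comap g ⊓ I ^ n • ⊤
  mono n := inf_le_inf (Submodule.comap_mono ((I.shiftedFiltration C d).mono n))
    ((I.stableFiltration (⊤ : Submodule R B)).mono n)
  smul_le n := le_inf
    ((smul_mono_right I inf_le_left).trans (Submodule.smul_le.2 fun r hr x hx ↦ by
      rw [Submodule.mem_comap, map_smul]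
      exact (I.shiftedFiltration C d).smul_le n (smul_mem_smul hr hx)))
    ((smul_mono_right I inf_le_right).trans
      ((I.stableFiltration (⊤ : Submodule R B)).smul_le n))

/-- **Artin-Rees lemma** for the preimage of `I ^ n D` under a linear map. -/
theorem exists_sub_mem_pow_smul_top_of_map_mem {D : Type*} [AddCommGroup D] [Module R D]
    [Module.Finite R D] (h : B →ₗ[R] D) :
    ∃ d, ∀ n ≥ d, ∀ b, h b ∈ (I ^ n • ⊤ : Submodule R D) →
      ∃ u, h u = 0 ∧ b - u ∈ (I ^ (n - d) • ⊤ : Submodule R B) := by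
  obtain ⟨d, hd⟩ := I.exists_pow_inf_eq_pow_smul (LinearMap.range h)
  refine ⟨d, fun n hn b hb ↦ ?_⟩
  have : h b ∈ (I ^ (n - d) • ⊤ : Submodule R B).map h := by
    rw [Submodule.map_smul'', Submodule.map_top]
    exact smul_mono le_rfl inf_le_right ((hd n hn).le ⟨hb, b, rfl⟩)
  obtain ⟨e, he, heb⟩ := this
  exact ⟨b - e, by simp [heb], by simpa using he⟩

variable [Module.Finite R B]

theorem comapFiltration_stable (g : B →ₗ[R] C) (d : ℕ) : (I.comapFiltration g d).Stable :=
  (I.stableFiltration_stable (⊤ : Submodule R B)).of_le fun n ↦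
    (inf_le_right : (I.comapFiltration g d).N n ≤ (I.stableFiltration (⊤ : Submodule R B)).N n)

variable (B) in
theorem exists_finite_relAssociatedPrimes_top_subset :
    ∃ T : Set (Ideal R), T.Finite ∧
      ∀ n, relAssociatedPrimes (⊤ : Submodule R B) (I ^ n • ⊤) ⊆ T := by
  obtain ⟨T, hT, h⟩ := (I.stableFiltration_stable (⊤ : Submodule R B))
    |>.exists_finite_relAssociatedPrimes_subset (I.shiftedFiltration B 1)
  refine ⟨T, hT, fun n ↦ ?_⟩
  induction n with
  | zero => rw [relAssociatedPrimes_eq_empty (by simp)]; exact Set.empty_subset _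
  | succ n ih =>
    exact (relAssociatedPrimes_subset_union ⊤
      (smul_mono_left (Ideal.pow_le_pow_right n.le_succ))).trans (Set.union_subset ih (h n))

variable [Module.Finite R C] in
theorem exists_sub_mem_pow_smul_top (p : Ideal R) (g : B →ₗ[R] C) :
    ∃ d, ∀ n ≥ d, ∀ b, g b ∈ (I ^ n • ⊤ : Submodule R C) →
      (∀ r ∈ p, r • b ∈ (I ^ n • ⊤ : Submodule R B)) →
      ∃ u, g u = 0 ∧ (∀ r ∈ p, r • u = 0) ∧ b - u ∈ (I ^ (n - d) • ⊤ : Submodule R B) := by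
  classical
  obtain ⟨s, hs⟩ := IsNoetherian.noetherian p
  obtain ⟨d, hd⟩ := I.exists_sub_mem_pow_smul_top_of_map_mem
    (g.prod (LinearMap.pi fun r : s ↦ LinearMap.lsmul R B r))
  refine ⟨d, fun n hn b hgb hb ↦ ?_⟩
  have h₁ := Submodule.mem_map_of_mem (f := LinearMap.inl R C (s → B)) hgb
  have h₂ (r : s) := Submodule.mem_map_of_mem
    (f := LinearMap.inr R C (s → B) ∘ₗ LinearMap.single R (fun _ : s ↦ B) r)
    (hb r (hs ▸ Submodule.subset_span r.2))
  simp only [Submodule.map_smul''] at h₁ h₂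
  have h := add_mem (smul_mono le_rfl le_top h₁)
    (Submodule.sum_mem _ fun r (_ : r ∈ Finset.univ) ↦ smul_mono le_rfl le_top (h₂ r))
  obtain ⟨u, hu, hbu⟩ := hd n hn b <| by
    convert h
    simp only [LinearMap.coe_comp, Function.comp_apply, ← map_sum]
    ext r <;> simp [Prod.fst_sum, Prod.snd_sum, Finset.sum_apply, Pi.single_apply]
  simp only [LinearMap.prod_apply, Function.prod_apply, Prod.mk_eq_zero] at hu
  refine ⟨u, hu.1, fun r hr ↦ ?_, hbu⟩
  have : p ≤ (⊥ : Submodule R B).colon {u} := hs.ge.trans <| Submodule.span_le.2 fun a ha ↦ by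
    rw [SetLike.mem_coe, mem_colon_singleton, Submodule.mem_bot]
    exact congr_fun hu.2 ⟨a, ha⟩
  simpa [mem_colon_singleton] using this hr

variable (B) in
theorem exists_eq_zero_of_mem_pow_smul_top :
    ∃ k, ∀ n ≥ k, ∀ b ∈ (I ^ n • ⊤ : Submodule R B), (∀ r ∈ I, r • b = 0) → b = 0 := by
  let W : Submodule R B := ⨅ r : I, LinearMap.ker (LinearMap.lsmul R B r)
  have hW {b : B} : b ∈ W ↔ ∀ r ∈ I, r • b = 0 := by simp [W]
  obtain ⟨k, hk⟩ := I.exists_pow_inf_eq_pow_smul W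
  refine ⟨k + 1, fun n hn b hb hIb ↦ ?_⟩
  have h := (hk n (by lia)).le ⟨hb, hW.2 hIb⟩
  have h' := smul_mono (Ideal.pow_le_self (show n - k ≠ 0 by lia)) inf_le_right h
  suffices I • W ≤ ⊥ from (Submodule.mem_bot R).1 (this h')
  exact Submodule.smul_le.2 fun r hr x hx ↦ (Submodule.mem_bot R).2 (hW.1 hx r hr)

variable [Module.Finite R C] in
theorem exists_relAssociatedPrimes_comap_eq (g : B →ₗ[R] C) :
    ∃ k, ∀ n ≥ k,
      relAssociatedPrimes ((I ^ n • ⊤ : Submodule R C).comap g) (I ^ n • ⊤) =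
      relAssociatedPrimes ((I ^ k • ⊤ : Submodule R C).comap g) (I ^ k • ⊤) := by
  obtain ⟨T, hT, hTn⟩ := I.exists_finite_relAssociatedPrimes_top_subset B
  choose δ hδ using fun p : Ideal R ↦ I.exists_sub_mem_pow_smul_top p g
  obtain ⟨d, hd⟩ := (hT.image δ).bddAbove
  obtain ⟨n₁, hn₁⟩ := (I.comapFiltration_stable g d).exists_relAssociatedPrimes_eq
    (I.shiftedFiltration B d)
  obtain ⟨n₂, hn₂⟩ := I.exists_eq_zero_of_mem_pow_smul_top B
  suffices H : ∀ n ≥ n₁ + n₂ + d + 1,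
      relAssociatedPrimes ((I ^ n • ⊤ : Submodule R C).comap g) (I ^ n • ⊤) =
        relAssociatedPrimes ((I.comapFiltration g d).N n₁) ((I.shiftedFiltration B d).N n₁) ∪
          {p | I ≤ p ∧ p ∈ relAssociatedPrimes (LinearMap.ker g) ⊥} from
    ⟨n₁ + n₂ + d + 1, fun n hn ↦ by rw [H n hn, H _ le_rfl]⟩
  intro n hn
  rw [← hn₁ (n - d) (by lia)]
  simp only [comapFiltration, shiftedFiltration, Nat.sub_add_cancel (show d ≤ n by lia)]
  refine Set.Subset.antisymm ?_ (Set.union_subset (relAssociatedPrimes_mono inf_le_left _) ?_)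
  · rintro p ⟨hp, b, hb, hr⟩
    have hpT := hTn n (relAssociatedPrimes_mono le_top _ ⟨hp, b, hb, hr⟩)
    have hIp : I ≤ p := hp.le_of_pow_le (n := n) fun r hrI ↦
      (hr r).2 (smul_mem_smul hrI mem_top)
    have hδd : δ p ≤ d := hd ⟨p, hpT, rfl⟩
    obtain ⟨u, hgu, hpu, hbu⟩ := hδ p n (by lia) b hb fun r ↦ (hr r).1
    replace hbu := smul_mono_left (Ideal.pow_le_pow_right (show n - d ≤ n - δ p by lia)) hbu
    by_cases hs : ∃ s ∉ p, s • (b - u) ∈ (I ^ n • ⊤ : Submodule R B)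
    · obtain ⟨s, hsp, hs⟩ := hs
      refine .inr ⟨hIp, hp, s • u, by simp [hgu], fun r ↦ ⟨fun h ↦ ?_, fun h ↦ ?_⟩⟩
      · rw [smul_comm, hpu r h, smul_zero, Submodule.mem_bot]
      · refine (hp.mem_or_mem ((hr (r * s)).2 ?_)).resolve_right hsp
        have := add_mem (smul_mem _ r hs) ((bot_le : ⊥ ≤ (I ^ n • ⊤ : Submodule R B)) h)
        rwa [← smul_add, ← smul_add, sub_add_cancel, smul_smul] at this
    · push Not at hs
      refine .inl ⟨hp, b - u, ⟨by simpa [hgu] using hb, hbu⟩, fun r ↦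
        ⟨fun h ↦ ?_, fun h ↦ by_contra (hs r · h)⟩⟩
      rw [smul_sub, hpu r h, sub_zero]
      exact (hr r).1 h
  · rintro p ⟨hIp, hp, u, hu, hr⟩
    refine ⟨hp, u, by simp [LinearMap.mem_ker.1 hu], fun r ↦ ⟨fun h ↦ ?_, fun h ↦ (hr r).2 ?_⟩⟩
    · exact bot_le (a := (I ^ n • ⊤ : Submodule R B)) ((hr r).1 h)
    · refine (Submodule.mem_bot R).2 (hn₂ n (by lia) _ h fun a ha ↦ ?_)
      rw [smul_comm, (Submodule.mem_bot R).1 ((hr a).1 (hIp ha)), smul_zero]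

end Ideal

section FGModuleCat

variable {R : Type} [CommRing R] [IsNoetherianRing R]

theorem FGModuleCat.exists_epi_of_pi (X : FGModuleCat.{0} R) :
    ∃ (n : ℕ) (f : FGModuleCat.of R (Fin n → R) ⟶ X), Epi f := by
  obtain ⟨n, f, hf⟩ := Module.Finite.exists_fin' R X
  refine ⟨n, FGModuleCat.ofHom f, ?_⟩
  apply (forget₂ (FGModuleCat R) (ModuleCat R)).epi_of_epi_map
  rw [ModuleCat.epi_iff_surjective]
  exact hf

instance FGModuleCat.projective_of (V : Type) [AddCommGroup V] [Module R V] [Module.Finite R V]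
    [Module.Projective R V] : Projective (FGModuleCat.of R V) where
  factors {E X} f e _ := by
    have : Epi ((forget₂ (FGModuleCat R) (ModuleCat R)).map e) := inferInstance
    rw [ModuleCat.epi_iff_surjective] at this
    obtain ⟨g, hg⟩ := Module.projective_lifting_property e.hom.hom f.hom.hom this
    exact ⟨FGModuleCat.ofHom g, FGModuleCat.hom_ext hg⟩

instance FGModuleCat.enoughProjectives : EnoughProjectives (FGModuleCat.{0} R) where
  presentation X := by
    obtain ⟨n, f, hf⟩ := FGModuleCat.exists_epi_of_pi X
    exact ⟨{ p := _, projective := inferInstance, f := f, epi := hf }⟩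

instance FGModuleCat.forget₂_preservesProjectiveObjects :
    (forget₂ (FGModuleCat.{0} R) (ModuleCat.{0} R)).PreservesProjectiveObjects where
  projective_obj {P} hP := by
    obtain ⟨n, f, hf⟩ := FGModuleCat.exists_epi_of_pi P
    have : Projective ((forget₂ (FGModuleCat R) (ModuleCat R)).obj
        (FGModuleCat.of R (Fin n → R))) :=
      inferInstanceAs (Projective (ModuleCat.of R (Fin n → R)))
    exact ((Retract.mk (Projective.factorThru (𝟙 P) f) f (by simp)).map
      (forget₂ (FGModuleCat R) (ModuleCat R))).projective

variable (R) in
theorem ModuleCat.exists_projectiveResolution_finite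
    (M : Type) [AddCommGroup M] [Module R M] [Module.Finite R M] :
    ∃ P : ProjectiveResolution (ModuleCat.of R M), ∀ n, Module.Finite R (P.complex.X n) :=
  ⟨(forget₂ (FGModuleCat R) (ModuleCat R)).mapProjectiveResolution
    (ProjectiveResolution.of (FGModuleCat.of R M)), fun n ↦
    inferInstanceAs (Module.Finite R ((ProjectiveResolution.of (FGModuleCat.of R M)).complex.X n))⟩

end FGModuleCat

section Hom

variable {R N P P₀ P₁ P₂ : Type*} [CommRing R] [AddCommGroup N] [Module R N]
  [AddCommGroup P] [Module R P] [AddCommGroup P₀] [Module R P₀] [AddCommGroup P₁] [Module R P₁]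
  [AddCommGroup P₂] [Module R P₂]

theorem LinearMap.mem_smul_top_iff_mkQ_comp_eq_zero [Module.Finite R P] [Module.Projective R P]
    (J : Ideal R) (w : P →ₗ[R] N) :
    w ∈ (J • ⊤ : Submodule R (P →ₗ[R] N)) ↔ (J • ⊤ : Submodule R N).mkQ ∘ₗ w = 0 := by
  rw [← LinearMap.range_le_ker_iff, Submodule.ker_mkQ, LinearMap.range_le_iff_comap,
    Submodule.eq_top_iff']
  constructor
  · intro hw x
    have := Submodule.mem_map_of_mem (f := LinearMap.applyₗ (R := R) (M₂ := N) x) hw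
    rw [Submodule.map_smul''] at this
    exact Submodule.smul_mono le_rfl le_top this
  · intro hw
    obtain ⟨n, f, g, -, -, hfg⟩ := Module.Finite.exists_comp_eq_id_of_projective R P
    have key : w = ∑ i, (LinearMap.toSpanSingleton R N (w (f (Pi.single i 1)))) ∘ₗ
        LinearMap.proj i ∘ₗ g := by
      ext x
      have hx : x = ∑ i, g x i • f (Pi.single i 1) := by
        conv_lhs => rw [← LinearMap.id_apply (R := R) x, ← hfg, LinearMap.comp_apply,
          pi_eq_sum_univ' (g x)]
        simp
      conv_lhs => rw [hx]
      simp
    rw [key]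
    refine Submodule.sum_mem _ fun i _ ↦ ?_
    have := Submodule.mem_map_of_mem (f := (LinearMap.lcomp R N (LinearMap.proj i ∘ₗ g)) ∘ₗ
      (LinearMap.ringLmapEquivSelf R R N).symm.toLinearMap)
      (Submodule.mem_comap.1 (hw (f (Pi.single i 1))))
    rw [Submodule.map_smul''] at this
    exact Submodule.smul_mono le_rfl le_top this

theorem associatedPrimes_hom_homology_eq [IsNoetherianRing R] [Module.Projective R P₀]
    [Module.Finite R P₁] [Module.Projective R P₁] [Module.Finite R P₂] [Module.Projective R P₂]
    {a : P₂ →ₗ[R] P₁} {b : P₁ →ₗ[R] P₀}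
    (hab : LinearMap.range (LinearMap.lcomp R N b) ≤ LinearMap.ker (LinearMap.lcomp R N a))
    (J : Ideal R) {X : Type*} [AddCommGroup X] [Module R X]
    {ρ : LinearMap.ker (LinearMap.lcomp R (N ⧸ (J • ⊤ : Submodule R N)) a) →ₗ[R] X}
    (hρ : Function.Surjective ρ) (hρ₀ : ∀ φ, ρ φ = 0 ↔ ∃ ψ, ψ ∘ₗ b = φ.1) :
    associatedPrimes R X = Submodule.relAssociatedPrimes
      ((J • ⊤ : Submodule R (P₂ →ₗ[R] N)).comap
        ((LinearMap.range (LinearMap.lcomp R N b)).liftQ (LinearMap.lcomp R N a) hab))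
      (J • ⊤) := by
  let m : (P₁ →ₗ[R] N) →ₗ[R] P₁ →ₗ[R] N ⧸ (J • ⊤ : Submodule R N) :=
    LinearMap.compRight R (J • ⊤ : Submodule R N).mkQ
  let Z := (LinearMap.ker (LinearMap.lcomp R (N ⧸ (J • ⊤ : Submodule R N)) a)).comap m
  let m' : Z →ₗ[R] LinearMap.ker (LinearMap.lcomp R (N ⧸ (J • ⊤ : Submodule R N)) a) :=
    m.restrict fun _ h ↦ h
  have hm' : Function.Surjective m' := by
    rintro ⟨φ, hφ⟩
    obtain ⟨w, hw⟩ := Module.projective_lifting_property (J • ⊤ : Submodule R N).mkQ φ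
      (Submodule.mkQ_surjective _)
    obtain rfl : m w = φ := hw
    exact ⟨⟨w, hφ⟩, rfl⟩
  refine Submodule.associatedPrimes_eq_relAssociatedPrimes (Z := Z) (π := ρ ∘ₗ m')
    (hρ.comp hm') (Submodule.mkQ_surjective (LinearMap.range (LinearMap.lcomp R N b)))
    (fun w ↦ ?_) fun w ↦ ?_
  · change _ ↔ LinearMap.lcomp R N a w ∈ (J • ⊤ : Submodule R (P₂ →ₗ[R] N))
    rw [LinearMap.mem_smul_top_iff_mkQ_comp_eq_zero]
    rfl
  · rw [LinearMap.comp_apply, hρ₀]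
    change (∃ ψ, ψ ∘ₗ b = (J • ⊤ : Submodule R N).mkQ ∘ₗ w.1) ↔ _
    have htop : (J • ⊤ : Submodule R ((P₁ →ₗ[R] N) ⧸ LinearMap.range (LinearMap.lcomp R N b))) =
        (J • ⊤ : Submodule R (P₁ →ₗ[R] N)).map (Submodule.mkQ _) := by
      rw [Submodule.map_smul'', Submodule.map_top, Submodule.range_mkQ]
    rw [htop, ← Submodule.mem_comap, Submodule.comap_map_mkQ, Submodule.mem_sup]
    constructor
    · rintro ⟨ψ, hψ⟩
      obtain ⟨ψ, rfl⟩ := Module.projective_lifting_property (J • ⊤ : Submodule R N).mkQ ψ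
        (Submodule.mkQ_surjective _)
      refine ⟨ψ ∘ₗ b, ⟨ψ, rfl⟩, w - ψ ∘ₗ b, ?_, add_sub_cancel _ _⟩
      rw [LinearMap.mem_smul_top_iff_mkQ_comp_eq_zero, LinearMap.comp_sub, ← hψ,
        LinearMap.comp_assoc, sub_self]
    · rintro ⟨_, ⟨ψ, rfl⟩, v, hv, hw⟩
      rw [LinearMap.mem_smul_top_iff_mkQ_comp_eq_zero] at hv
      refine ⟨(J • ⊤ : Submodule R N).mkQ ∘ₗ ψ, ?_⟩
      rw [← hw, LinearMap.comp_add, hv, add_zero]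
      rfl

end Hom

theorem CategoryTheory.ProjectiveResolution.exists_surjective_ext {R : Type} [CommRing R]
    {M : ModuleCat.{0} R} (P : ProjectiveResolution M) (Y : Type) [AddCommGroup Y] [Module R Y]
    (i : ℕ) :
    ∃ ρ : LinearMap.ker (LinearMap.lcomp R Y (P.complex.d ((ComplexShape.up ℕ).next i) i).hom) →ₗ[R]
        (((Ext R (ModuleCat R) i).obj (Opposite.op M)).obj (ModuleCat.of R Y)),
      Function.Surjective ρ ∧ ∀ φ, ρ φ = 0 ↔
        ∃ ψ, ψ ∘ₗ (P.complex.d i ((ComplexShape.up ℕ).prev i)).hom = φ.1 := by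
  let S := (P.complex.linearYonedaObj R (ModuleCat.of R Y)).sc i
  let e : (((Ext R (ModuleCat R) i).obj (Opposite.op M)).obj (ModuleCat.of R Y)) ≃ₗ[R]
      (LinearMap.ker S.g.hom ⧸ LinearMap.range S.moduleCatToCycles) :=
    (P.isoExt i (ModuleCat.of R Y) ≪≫ S.moduleCatHomologyIso).toLinearEquiv
  let t : (P.complex.X i →ₗ[R] Y) →ₗ[R] S.X₂ :=
    (ModuleCat.homLinearEquiv (S := R) (M := P.complex.X i) (N := ModuleCat.of R Y)).symm.toLinearMap
  have ht (φ : P.complex.X i →ₗ[R] Y) : t φ = ModuleCat.ofHom φ := rfl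
  have ht' (φ : P.complex.X i →ₗ[R] Y) : φ ∈ LinearMap.ker
      (LinearMap.lcomp R Y (P.complex.d ((ComplexShape.up ℕ).next i) i).hom) ↔
      t φ ∈ LinearMap.ker S.g.hom := by
    rw [LinearMap.mem_ker, LinearMap.mem_ker]
    exact (ModuleCat.hom_ext_iff (f := P.complex.d ((ComplexShape.up ℕ).next i) i ≫
      ModuleCat.ofHom φ) (g := 0)).symm
  let ρ := (LinearMap.range S.moduleCatToCycles).mkQ ∘ₗ t.restrict fun φ h ↦ (ht' φ).1 h
  refine ⟨e.symm.toLinearMap ∘ₗ ρ, ?_, fun φ ↦ ?_⟩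
  · refine e.symm.surjective.comp ((Submodule.mkQ_surjective _).comp ?_)
    rintro ⟨x, hx⟩
    exact ⟨⟨ModuleCat.Hom.hom (A := P.complex.X i) (B := ModuleCat.of R Y) x, (ht' _).2 hx⟩, rfl⟩
  · rw [LinearMap.comp_apply, LinearEquiv.coe_coe, e.symm.map_eq_zero_iff, LinearMap.comp_apply,
      Submodule.mkQ_apply, Submodule.Quotient.mk_eq_zero, LinearMap.mem_range]
    constructor
    · rintro ⟨ψ, hψ⟩
      exact ⟨ModuleCat.Hom.hom (A := P.complex.X _) (B := ModuleCat.of R Y) ψ,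
        congr_arg (ModuleCat.Hom.hom (A := P.complex.X _) (B := ModuleCat.of R Y))
          (congr_arg Subtype.val hψ)⟩
    · rintro ⟨ψ, hψ⟩
      exact ⟨ModuleCat.ofHom ψ, Subtype.ext (ModuleCat.hom_ext hψ)⟩

/-- **Katz–West (Ext, special case).** For finitely generated modules `M`, `N` over a
commutative Noetherian ring `R`, an ideal `I` and fixed `i`, the set of associated
primes of `Ext_R^i(M, N/IⁿN)` is independent of `n` for all sufficiently large `n`. -/
theorem ass_ext_quotient_power_stable (R : Type) [CommRing R] [IsNoetherianRing R]
    (I : Ideal R) (M N : Type) [AddCommGroup M] [Module R M] [Module.Finite R M]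
    [AddCommGroup N] [Module R N] [Module.Finite R N] (i : ℕ) :
    ∃ K : ℕ, ∀ n : ℕ, K ≤ n →
      associatedPrimes R
        (((Ext R (ModuleCat R) i).obj (Opposite.op (ModuleCat.of R M))).obj
          (ModuleCat.of R (N ⧸ (I ^ n • (⊤ : Submodule R N))))) =
      associatedPrimes R
        (((Ext R (ModuleCat R) i).obj (Opposite.op (ModuleCat.of R M))).obj
          (ModuleCat.of R (N ⧸ (I ^ K • (⊤ : Submodule R N))))) := by
  obtain ⟨P, hP⟩ := ModuleCat.exists_projectiveResolution_finite R M
  have hP' (j : ℕ) : Module.Projective R (P.complex.X j) := inferInstance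
  have hd : LinearMap.range (LinearMap.lcomp R N (P.complex.d i ((ComplexShape.up ℕ).prev i)).hom) ≤
      LinearMap.ker (LinearMap.lcomp R N (P.complex.d ((ComplexShape.up ℕ).next i) i).hom) := by
    rintro _ ⟨ψ, rfl⟩
    rw [LinearMap.mem_ker, LinearMap.lcomp_apply', LinearMap.lcomp_apply', LinearMap.comp_assoc,
      ← ModuleCat.hom_comp, HomologicalComplex.d_comp_d, ModuleCat.hom_zero, LinearMap.comp_zero]
  have h (J : Ideal R) : associatedPrimes R
      (((Ext R (ModuleCat R) i).obj (Opposite.op (ModuleCat.of R M))).obj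
        (ModuleCat.of R (N ⧸ (J • ⊤ : Submodule R N)))) =
      Submodule.relAssociatedPrimes
        ((J • ⊤ : Submodule R (P.complex.X ((ComplexShape.up ℕ).next i) →ₗ[R] N)).comap
          (Submodule.liftQ _ _ hd)) (J • ⊤) := by
    obtain ⟨ρ, hρ, hρ₀⟩ := P.exists_surjective_ext (N ⧸ (J • ⊤ : Submodule R N)) i
    exact associatedPrimes_hom_homology_eq hd J hρ hρ₀
  obtain ⟨K, hK⟩ := I.exists_relAssociatedPrimes_comap_eq (Submodule.liftQ _ _ hd)
  exact ⟨K, fun n hn ↦ by rw [h, h, hK n hn]⟩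
end

section
/- Let R be a commutative Noetherian ring, I an ideal, M and N finitely generated R-modules, and fix i ≥ 0. Then the set Ass_R(Tor_i^R(M, N/I^n N)) is independent of n for all sufficiently large n. -/
open CategoryTheory

theorem associatedPrimes.finite_of_isScalarTower (R T E : Type*) [CommRing R] [IsNoetherianRing R]
    [CommRing T] [IsNoetherianRing T] [Algebra R T] [AddCommGroup E] [Module T E] [Module R E]
    [IsScalarTower R T E] [Module.Finite T E] : (associatedPrimes R E).Finite := by
  rename_i _ _ _ _ _ _ modR tower fin
  revert modR tower
  induction fin using IsNoetherianRing.induction_on_isQuotientEquivQuotientPrime T with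
  | subsingleton N =>
    intro _ _
    simp [associatedPrimes.eq_empty_of_subsingleton]
  | quotient N p f =>
    intro _ _
    rw [LinearEquiv.AssociatedPrimes.eq (f.restrictScalars R)]
    refine (Set.finite_singleton (p.1.comap (algebraMap R T))).subset fun J hJ ↦ ?_
    obtain ⟨hJp, x, rfl⟩ := isAssociatedPrime_iff.mp hJ
    have := p.2
    obtain ⟨t, rfl⟩ := Ideal.Quotient.mk_surjective x
    have ht : t ∉ p.1 := fun h ↦ hJp.ne_top <| by
      rw [Ideal.Quotient.eq_zero_iff_mem.mpr h]; simp
    ext r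
    rw [Submodule.mem_colon_singleton, Submodule.mem_bot, Ideal.mem_comap, ← Ideal.Quotient.mk_eq_mk,
      ← Submodule.Quotient.mk_smul, Submodule.Quotient.mk_eq_zero, Algebra.smul_def,
      p.2.mul_mem_iff_mem_or_mem, or_iff_left ht]
  | exact N₁ N₂ N₃ f g hf _ hfg h₁ h₃ =>
    intro _ _
    let _ : Module R N₁ := Module.compHom N₁ (algebraMap R T)
    let _ : Module R N₃ := Module.compHom N₃ (algebraMap R T)
    have : IsScalarTower R T N₁ := .of_algebraMap_smul fun _ _ ↦ rfl
    have : IsScalarTower R T N₃ := .of_algebraMap_smul fun _ _ ↦ rfl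
    exact (h₁.union h₃).subset (associatedPrimes.subset_union_of_exact
      (f := f.restrictScalars R) (g := g.restrictScalars R) hf hfg)

section

variable {R B : Type*} [CommRing R] [IsNoetherianRing R] (I : Ideal R)
  [AddCommGroup B] [Module R B] [Module.Finite R B]

theorem finite_isPrime_colon_pow_succ_smul_top :
    {p : Ideal R | p.IsPrime ∧ ∃ j, ∃ x ∈ (I ^ j • ⊤ : Submodule R B),
      (I ^ (j + 1) • ⊤ : Submodule R B).colon {x} = p}.Finite := by
  let F := I.stableFiltration (⊤ : Submodule R B)
  let G : I.Filtration B :=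
    { N := fun j ↦ F.N (j + 1)
      mono := fun j ↦ F.mono (j + 1)
      smul_le := fun j ↦ F.smul_le (j + 1) }
  have hfg : F.submodule.FG :=
    (F.submodule_fg_iff_stable fun _ ↦ IsNoetherian.noetherian _).mpr
      (I.stableFiltration_stable _)
  have : Module.Finite (reesAlgebra I) (F.submodule.map G.submodule.mkQ) :=
    Module.Finite.iff_fg.mpr (hfg.map _)
  refine (associatedPrimes.finite_of_isScalarTower R (reesAlgebra I)
    (F.submodule.map G.submodule.mkQ)).subset ?_
  rintro p ⟨hp, j, x, hx, rfl⟩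
  have key (H : I.Filtration B) (y : B) :
      PolynomialModule.single R j y ∈ H.submodule ↔ y ∈ H.N j := by
    refine ⟨fun h ↦ by simpa using h j, fun h i ↦ ?_⟩
    rw [PolynomialModule.coeff_single, Finsupp.single_apply]
    split_ifs with hij
    · exact hij ▸ h
    · exact zero_mem _
  have hxF : PolynomialModule.single R j x ∈ F.submodule := (key F x).mpr hx
  refine isAssociatedPrime_iff.mpr ⟨hp, ⟨_, Submodule.mem_map_of_mem hxF⟩, ?_⟩
  ext r
  have hr : r • PolynomialModule.single R j x = PolynomialModule.single R j (r • x) :=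
    (map_smul (PolynomialModule.lsingle R j) r x).symm
  rw [Submodule.mem_colon_singleton, Submodule.mem_colon_singleton, Submodule.mem_bot,
    Subtype.ext_iff]
  refine (key G (r • x)).symm.trans (hr ▸ (Submodule.Quotient.mk_eq_zero _).symm.trans ?_)
  exact Iff.rfl

theorem finite_isPrime_colon_pow_smul_top :
    {p : Ideal R | p.IsPrime ∧ ∃ n, ∃ x, (I ^ n • ⊤ : Submodule R B).colon {x} = p}.Finite := by
  refine (finite_isPrime_colon_pow_succ_smul_top (B := B) I).subset ?_
  rintro p ⟨hp, n, x, hx⟩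
  refine ⟨hp, ?_⟩
  induction n with
  | zero => exact (hp.ne_top (by simp [← hx])).elim
  | succ n ih =>
    by_cases h : ∃ s ∉ p, s • x ∈ (I ^ n • ⊤ : Submodule R B)
    · obtain ⟨s, hs, hsx⟩ := h
      refine ⟨n, s • x, hsx, ?_⟩
      ext r
      rw [Submodule.mem_colon_singleton, smul_smul, ← Submodule.mem_colon_singleton, hx,
        hp.mul_mem_iff_mem_or_mem, or_iff_left hs]
    · push Not at h
      refine ih (le_antisymm (fun r hr ↦ ?_) ?_)
      · by_contra hrp
        exact h r hrp (Submodule.mem_colon_singleton.mp hr)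
      · rw [← hx]
        exact Submodule.colon_mono (Submodule.smul_mono_left (Ideal.pow_le_pow_right n.le_succ)) le_rfl

end

section

variable {R B C : Type*} [CommRing R] [AddCommGroup B] [Module R B] [AddCommGroup C] [Module R C]

theorem apply_mem_smul_top (f : B →ₗ[R] C) {J : Ideal R} {x : B}
    (hx : x ∈ (J • ⊤ : Submodule R B)) : f x ∈ (J • ⊤ : Submodule R C) := by
  have := Submodule.mem_map_of_mem (f := f) hx
  rw [Submodule.map_smul''] at this
  exact Submodule.smul_mono le_rfl le_top this

theorem mem_smul_top_pi {ι : Type*} [Finite ι] {J : Ideal R} {x : ι → B}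
    (hx : ∀ j, x j ∈ (J • ⊤ : Submodule R B)) : x ∈ (J • ⊤ : Submodule R (ι → B)) := by
  classical
  cases nonempty_fintype ι
  rw [← Finset.univ_sum_single x]
  exact sum_mem fun j _ ↦ apply_mem_smul_top (LinearMap.single R (fun _ ↦ B) j) (hx j)

theorem mem_smul_top_prod {J : Ideal R} {x : B × C} (h₁ : x.1 ∈ (J • ⊤ : Submodule R B))
    (h₂ : x.2 ∈ (J • ⊤ : Submodule R C)) : x ∈ (J • ⊤ : Submodule R (B × C)) := by
  rw [← Prod.fst_add_snd x]
  exact add_mem (apply_mem_smul_top (LinearMap.inl R B C) h₁)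
    (apply_mem_smul_top (LinearMap.inr R B C) h₂)

theorem exists_comap_pow_smul_top_eq [IsNoetherianRing R] [Module.Finite R C] (I : Ideal R)
    (f : B →ₗ[R] C) : ∃ k, ∃ Y : Submodule R B,
      ∀ m, (I ^ (k + m) • ⊤ : Submodule R C).comap f = LinearMap.ker f ⊔ I ^ m • Y := by
  obtain ⟨k, hk⟩ := I.exists_pow_inf_eq_pow_smul (LinearMap.range f)
  refine ⟨k, (I ^ k • ⊤ : Submodule R C).comap f, fun m ↦ ?_⟩
  have := hk (k + m) (by lia)
  rw [Nat.add_sub_cancel_left, inf_comm, inf_comm _ (LinearMap.range f), ← Submodule.map_comap_eq,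
    ← Submodule.map_comap_eq, ← Submodule.map_smul''] at this
  have h := congr_arg (Submodule.comap f) this
  rw [Submodule.comap_map_eq, Submodule.comap_map_eq, sup_eq_left.mpr] at h
  · rw [h, sup_comm]
  · exact LinearMap.ker_le_comap _

/-- Whether a prime is the colon ideal `(IⁿB : x)` of some `x` with `f x ∈ IⁿC` does not depend on
`n`, for `n` large. -/
theorem eventually_colon_pow_smul_top_iff [IsNoetherianRing R] [Module.Finite R B]
    [Module.Finite R C] (I : Ideal R) (f : B →ₗ[R] C) (p : Ideal R) [hp : p.IsPrime] :
    ∃ Q : Prop, ∃ K, ∀ n ≥ K, (∃ x, f x ∈ (I ^ n • ⊤ : Submodule R C) ∧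
      (I ^ n • ⊤ : Submodule R B).colon {x} = p) ↔ Q := by
  have anti {m n : ℕ} (h : m ≤ n) : (I ^ n • ⊤ : Submodule R B) ≤ I ^ m • ⊤ :=
    Submodule.smul_mono_left (Ideal.pow_le_pow_right h)
  obtain ⟨r, g, rfl⟩ := Submodule.fg_iff_exists_fin_generating_family.mp
    (IsNoetherian.noetherian p)
  set p := Submodule.span R (Set.range g) with hpdef
  let φ : B →ₗ[R] C × (Fin r → B) :=
    f.prod (LinearMap.pi fun j ↦ LinearMap.lsmul R B (g j))
  have mem_comap (n : ℕ) (x : B) : x ∈ (I ^ n • ⊤ : Submodule R (C × (Fin r → B))).comap φ ↔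
      f x ∈ (I ^ n • ⊤ : Submodule R C) ∧ p ≤ (I ^ n • ⊤ : Submodule R B).colon {x} := by
    rw [hpdef, Submodule.span_le, Set.range_subset_iff, Submodule.mem_comap]
    simp only [SetLike.mem_coe, Submodule.mem_colon_singleton]
    refine ⟨fun h ↦ ⟨apply_mem_smul_top (LinearMap.fst R _ _) h, fun j ↦ ?_⟩, fun h ↦ ?_⟩
    · exact apply_mem_smul_top (LinearMap.proj j ∘ₗ LinearMap.snd R C (Fin r → B)) h
    · exact mem_smul_top_prod h.1 (mem_smul_top_pi h.2)
  have key (n : ℕ) : (∃ x, f x ∈ (I ^ n • ⊤ : Submodule R C) ∧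
      (I ^ n • ⊤ : Submodule R B).colon {x} = p) ↔
      ∃ x ∈ (I ^ n • ⊤ : Submodule R (C × (Fin r → B))).comap φ,
        ∀ s ∉ p, s • x ∉ (I ^ n • ⊤ : Submodule R B) := by
    simp only [mem_comap, and_assoc, le_antisymm_iff, ← Submodule.mem_colon_singleton]
    refine exists_congr fun x ↦ and_congr_right fun _ ↦ ?_
    rw [and_comm]
    refine and_congr_right fun _ ↦ ?_
    rw [SetLike.le_def]
    exact forall_congr' fun s ↦ not_imp_not.symm
  simp only [key]
  obtain ⟨k, Y, hY⟩ := exists_comap_pow_smul_top_eq I φ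
  by_cases hA : ∃ m, ∃ x ∈ LinearMap.ker φ, ∀ s ∉ p, s • x ∉ (I ^ m • ⊤ : Submodule R B)
  · obtain ⟨m, x, hx, h⟩ := hA
    refine ⟨True, m, fun n hn ↦ iff_true_intro ⟨x, LinearMap.ker_le_comap _ hx, fun s hs hsx ↦ ?_⟩⟩
    exact h s hs (anti hn hsx)
  push Not at hA
  -- In the remaining case, failure in one degree propagates to the next one.
  have step (m : ℕ) (h : ∀ x ∈ (I ^ (k + m) • ⊤ : Submodule R (C × (Fin r → B))).comap φ,
        ∃ s ∉ p, s • x ∈ (I ^ (k + m) • ⊤ : Submodule R B)) :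
      ∀ x ∈ (I ^ (k + (m + 1)) • ⊤ : Submodule R (C × (Fin r → B))).comap φ,
        ∃ s ∉ p, s • x ∈ (I ^ (k + (m + 1)) • ⊤ : Submodule R B) := by
    have exists_smul_add {n : ℕ} {x y : B} (hx : ∃ s ∉ p, s • x ∈ (I ^ n • ⊤ : Submodule R B))
        (hy : ∃ s ∉ p, s • y ∈ (I ^ n • ⊤ : Submodule R B)) :
        ∃ s ∉ p, s • (x + y) ∈ (I ^ n • ⊤ : Submodule R B) := by
      obtain ⟨s, hs, hsx⟩ := hx
      obtain ⟨t, ht, hty⟩ := hy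
      refine ⟨s * t, hp.mul_notMem hs ht, ?_⟩
      rw [smul_add]
      refine add_mem ?_ ?_
      · rw [mul_comm, mul_smul]
        exact Submodule.smul_mem _ _ hsx
      · rw [mul_smul]
        exact Submodule.smul_mem _ _ hty
    intro x hx
    rw [hY] at hx
    obtain ⟨z, hz, y, hy, rfl⟩ := Submodule.mem_sup.mp hx
    refine exists_smul_add (hA _ z hz) ?_
    rw [pow_succ', mul_smul] at hy
    refine Submodule.smul_induction_on hy (fun a ha y hy ↦ ?_) fun _ _ ↦ exists_smul_add
    obtain ⟨s, hs, hsy⟩ := h y (by rw [hY]; exact Submodule.mem_sup_right hy)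
    refine ⟨s, hs, ?_⟩
    rw [smul_comm, ← add_assoc, pow_succ', mul_smul]
    exact Submodule.smul_mem_smul ha hsy
  by_cases hB : ∃ m, ∀ x ∈ (I ^ (k + m) • ⊤ : Submodule R (C × (Fin r → B))).comap φ,
        ∃ s ∉ p, s • x ∈ (I ^ (k + m) • ⊤ : Submodule R B)
  · obtain ⟨m, hm⟩ := hB
    refine ⟨False, k + m, fun n hn ↦ iff_false_intro ?_⟩
    push Not
    obtain ⟨l, rfl⟩ := Nat.exists_eq_add_of_le hn
    rw [add_assoc]
    clear hn
    induction l with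
    | zero => exact hm
    | succ l ih => exact step _ ih
  · push Not at hB
    refine ⟨True, k, fun n hn ↦ iff_true_intro ?_⟩
    obtain ⟨l, rfl⟩ := Nat.exists_eq_add_of_le hn
    exact hB l

/-- The set of primes of the form `(IⁿB : x)` with `f x ∈ IⁿC` does not depend on `n`, for `n`
large. -/
theorem eventually_setOf_colon_pow_smul_top_eq [IsNoetherianRing R] [Module.Finite R B]
    [Module.Finite R C] (I : Ideal R) (f : B →ₗ[R] C) :
    ∃ S : Set (Ideal R), ∃ K, ∀ n ≥ K, {p : Ideal R | p.IsPrime ∧ ∃ x,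
      f x ∈ (I ^ n • ⊤ : Submodule R C) ∧ (I ^ n • ⊤ : Submodule R B).colon {x} = p} = S := by
  have fin := finite_isPrime_colon_pow_smul_top (B := B) I
  set T := {p : Ideal R | p.IsPrime ∧ ∃ n, ∃ x, (I ^ n • ⊤ : Submodule R B).colon {x} = p}
  have (p : T) := eventually_colon_pow_smul_top_iff I f p.1 (hp := p.2.1)
  choose Q K hQ using this
  have : Finite T := fin
  obtain ⟨L, hL⟩ := (Set.finite_range K).bddAbove
  refine ⟨{p | ∃ h : p ∈ T, Q ⟨p, h⟩}, L, fun n hn ↦ ?_⟩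
  ext p
  refine ⟨fun ⟨hp, x, hfx, hx⟩ ↦ ?_, fun ⟨h, hq⟩ ↦ ?_⟩
  · have hT : p ∈ T := ⟨hp, n, x, hx⟩
    exact ⟨hT, (hQ ⟨p, hT⟩ n ((hL ⟨_, rfl⟩).trans hn)).mp ⟨x, hfx, hx⟩⟩
  · exact ⟨h.1, (hQ ⟨p, h⟩ n ((hL ⟨_, rfl⟩).trans hn)).mpr hq⟩

open TensorProduct in
theorem ker_lTensor_mkQ_pow_smul_top (J : Ideal R) :
    LinearMap.ker ((J • ⊤ : Submodule R C).mkQ.lTensor B) = J • ⊤ := by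
  rw [lTensor_mkQ]
  apply le_antisymm
  · rintro _ ⟨x, rfl⟩
    induction x with
    | zero => simp
    | add x y hx hy => rw [map_add]; exact add_mem hx hy
    | tmul b c => exact apply_mem_smul_top (TensorProduct.mk R B C b) c.2
  · refine Submodule.smul_le.mpr fun r hr x _ ↦ ?_
    induction x with
    | zero => simp
    | add x y hx hy => rw [smul_add]; exact add_mem (hx trivial) (hy trivial)
    | tmul b c =>
      exact ⟨b ⊗ₜ ⟨r • c, Submodule.smul_mem_smul hr trivial⟩, by simp⟩

open TensorProduct in
/-- For `f : A → C`, the associated primes of the kernel of `A ⊗ N/IⁿN → C ⊗ N/IⁿN` do not depend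
on `n`, for `n` large. -/
theorem eventually_associatedPrimes_ker_rTensor_eq {A N : Type*} [AddCommGroup A] [Module R A]
    [AddCommGroup N] [Module R N] [IsNoetherianRing R] [Module.Finite R A]
    [Module.Finite R C] [Module.Finite R N] (I : Ideal R) (f : A →ₗ[R] C) :
    ∃ S : Set (Ideal R), ∃ K, ∀ n ≥ K, associatedPrimes R
      (LinearMap.ker (f.rTensor (N ⧸ (I ^ n • ⊤ : Submodule R N)))) = S := by
  obtain ⟨S, K, h⟩ := eventually_setOf_colon_pow_smul_top_eq I (f.rTensor N)
  refine ⟨S, K, fun n hn ↦ (Set.ext fun p ↦ ?_).trans (h n hn)⟩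
  set q := (I ^ n • ⊤ : Submodule R N).mkQ
  have mem_ker (x : A ⊗[R] N) : x ∈ (I ^ n • ⊤ : Submodule R (A ⊗[R] N)) ↔ q.lTensor A x = 0 := by
    rw [← ker_lTensor_mkQ_pow_smul_top, LinearMap.mem_ker]
  have mem_ker' (x : A ⊗[R] N) : f.rTensor N x ∈ (I ^ n • ⊤ : Submodule R (C ⊗[R] N)) ↔
      q.lTensor A x ∈ LinearMap.ker (f.rTensor (N ⧸ (I ^ n • ⊤ : Submodule R N))) := by
    rw [← ker_lTensor_mkQ_pow_smul_top, LinearMap.mem_ker, LinearMap.mem_ker,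
      ← LinearMap.comp_apply, ← LinearMap.comp_apply, LinearMap.lTensor_comp_rTensor,
      LinearMap.rTensor_comp_lTensor]
  have colon_eq (x : A ⊗[R] N) (hx) : (⊥ : Submodule R (LinearMap.ker
      (f.rTensor (N ⧸ (I ^ n • ⊤ : Submodule R N))))).colon {⟨q.lTensor A x, hx⟩} =
        (I ^ n • ⊤ : Submodule R (A ⊗[R] N)).colon {x} := by
    ext r
    simp only [Submodule.mem_colon_singleton, mem_ker, Submodule.mem_bot, ← Subtype.val_inj,
      map_smul, Submodule.coe_smul, ZeroMemClass.coe_zero]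
  have surj : Function.Surjective (q.lTensor A) :=
    LinearMap.lTensor_surjective A (Submodule.mkQ_surjective _)
  refine isAssociatedPrime_iff.trans (and_congr_right fun hp ↦ ⟨?_, ?_⟩)
  · rintro ⟨⟨y, hy⟩, rfl⟩
    obtain ⟨x, rfl⟩ := surj y
    exact ⟨x, (mem_ker' x).mpr hy, (colon_eq x hy).symm⟩
  · rintro ⟨x, hx, rfl⟩
    exact ⟨⟨_, (mem_ker' x).mp hx⟩, (colon_eq x _).symm⟩

end

theorem CategoryTheory.ProjectiveResolution.homologyMap_comp_fromLeftDerivedZero'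
    {C D : Type*} [Category* C] [Category* D] [Abelian C] [Abelian D]
    {F G : C ⥤ D} [F.Additive] [G.Additive] (α : F ⟶ G) {X : C} (P : ProjectiveResolution X) :
    HomologicalComplex.homologyMap
        ((NatTrans.mapHomologicalComplex α (ComplexShape.down ℕ)).app P.complex) 0 ≫
        (ChainComplex.isoHomologyι₀ _).hom ≫ P.fromLeftDerivedZero' G =
      ((ChainComplex.isoHomologyι₀ _).hom ≫ P.fromLeftDerivedZero' F) ≫ α.app X := by
  have h : HomologicalComplex.opcyclesMap
      ((NatTrans.mapHomologicalComplex α (ComplexShape.down ℕ)).app P.complex) 0 ≫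
      P.fromLeftDerivedZero' G = P.fromLeftDerivedZero' F ≫ α.app X := by
    rw [← cancel_epi (HomologicalComplex.pOpcycles _ _),
      HomologicalComplex.p_opcyclesMap_assoc, P.pOpcycles_comp_fromLeftDerivedZero',
      P.pOpcycles_comp_fromLeftDerivedZero'_assoc]
    exact (α.naturality _).symm
  rw [Category.assoc, ← h]
  exact HomologicalComplex.homologyι_naturality_assoc _ _ _

section

open MonoidalCategory

universe u

variable {R : Type u} [CommRing R]

instance (X : ModuleCat.{u} R) :
    Limits.PreservesFiniteColimits ((tensoringLeft (ModuleCat.{u} R)).obj X) :=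
  inferInstanceAs (Limits.PreservesFiniteColimits (tensorLeft X))

theorem isZero_homology_succ_tensoringLeft {Q : ModuleCat.{u} R} (P : ProjectiveResolution Q)
    (X : ModuleCat.{u} R) [Module.Flat R X] (n : ℕ) :
    Limits.IsZero (((((tensoringLeft (ModuleCat.{u} R)).obj X).mapHomologicalComplex
      (ComplexShape.down ℕ)).obj P.complex).homology (n + 1)) := by
  have : Limits.PreservesFiniteLimits ((tensoringLeft (ModuleCat.{u} R)).obj X) :=
    inferInstanceAs (Limits.PreservesFiniteLimits (tensorLeft X))
  rw [← HomologicalComplex.exactAt_iff_isZero_homology]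
  exact ShortComplex.Exact.map (P.complex_exactAt_succ n)
    ((tensoringLeft (ModuleCat.{u} R)).obj X)

/-- The tensor product `X ⊗ P` of a module with a chain complex. -/
noncomputable abbrev tensorComplex (X : ModuleCat.{u} R) (P : ChainComplex (ModuleCat.{u} R) ℕ) :
    ChainComplex (ModuleCat.{u} R) ℕ :=
  (((tensoringLeft (ModuleCat.{u} R)).obj X).mapHomologicalComplex (ComplexShape.down ℕ)).obj P

/-- A short complex of modules tensored with a projective resolution of `Q`. -/
noncomputable def tensorResolution (S : ShortComplex (ModuleCat.{u} R)) {Q : ModuleCat.{u} R}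
    (P : ProjectiveResolution Q) : ShortComplex (ChainComplex (ModuleCat.{u} R) ℕ) where
  f := (NatTrans.mapHomologicalComplex ((tensoringLeft _).map S.f)
    (ComplexShape.down ℕ)).app P.complex
  g := (NatTrans.mapHomologicalComplex ((tensoringLeft _).map S.g)
    (ComplexShape.down ℕ)).app P.complex
  zero := by
    ext n : 1
    change S.f ▷ P.complex.X n ≫ S.g ▷ P.complex.X n = 0
    rw [← MonoidalCategory.comp_whiskerRight, S.zero, MonoidalPreadditive.zero_whiskerRight]

theorem shortExact_tensorResolution {S : ShortComplex (ModuleCat.{u} R)} (hS : S.ShortExact)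
    {Q : ModuleCat.{u} R} (P : ProjectiveResolution Q) : (tensorResolution S P).ShortExact := by
  refine HomologicalComplex.shortExact_of_degreewise_shortExact _ fun i ↦ ?_
  have : Module.Flat R (P.complex.X i) := by
    have := P.projective i
    infer_instance
  exact hS.map_of_exact (tensorRight (P.complex.X i))

theorem nonempty_iso_tor_of_shortExact {S : ShortComplex (ModuleCat.{u} R)} (hS : S.ShortExact)
    [Module.Flat R S.X₂] (Q : ModuleCat.{u} R) (n : ℕ) :
    Nonempty (((Tor (ModuleCat.{u} R) (n + 2)).obj S.X₃).obj Q ≅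
      ((Tor (ModuleCat.{u} R) (n + 1)).obj S.X₁).obj Q) := by
  let P := projectiveResolution Q
  have hK := shortExact_tensorResolution hS P
  have hij : (ComplexShape.down ℕ).Rel (n + 2) (n + 1) := rfl
  let δ : (tensorComplex S.X₃ P.complex).homology (n + 2) ⟶
    (tensorComplex S.X₁ P.complex).homology (n + 1) := hK.δ _ _ hij
  have hδ : IsIso δ := hK.isIso_δ _ _ hij (isZero_homology_succ_tensoringLeft P S.X₂ (n + 1))
    (isZero_homology_succ_tensoringLeft P S.X₂ n)
  exact ⟨P.isoLeftDerivedObj _ _ ≪≫ @asIso _ _ _ _ δ hδ ≪≫ (P.isoLeftDerivedObj _ _).symm⟩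

theorem nonempty_tor_zero_linearEquiv (X Q : ModuleCat.{u} R) :
    Nonempty (((Tor (ModuleCat.{u} R) 0).obj X).obj Q ≃ₗ[R] TensorProduct R X Q) :=
  ⟨(((tensoringLeft (ModuleCat.{u} R)).obj X).leftDerivedZeroIsoSelf.app Q).toLinearEquiv⟩

theorem nonempty_tor_one_linearEquiv {S : ShortComplex (ModuleCat.{u} R)} (hS : S.ShortExact)
    [Module.Flat R S.X₂] (Q : ModuleCat.{u} R) :
    Nonempty (((Tor (ModuleCat.{u} R) 1).obj S.X₃).obj Q ≃ₗ[R]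
      LinearMap.ker (S.f.hom.rTensor Q)) := by
  let P := projectiveResolution Q
  have hK := shortExact_tensorResolution hS P
  have hij : (ComplexShape.down ℕ).Rel 1 0 := rfl
  let δ : (tensorComplex S.X₃ P.complex).homology 1 ⟶
    (tensorComplex S.X₁ P.complex).homology 0 := hK.δ _ _ hij
  have hδ : Mono δ := (hK.homology_exact₃ _ _ hij).mono_g
    ((isZero_homology_succ_tensoringLeft P S.X₂ 0).eq_of_src _ _)
  have hex := hK.homology_exact₁ _ _ hij
  let e (X : ModuleCat.{u} R) := asIso ((ChainComplex.isoHomologyι₀ _).hom ≫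
    P.fromLeftDerivedZero' ((tensoringLeft (ModuleCat.{u} R)).obj X))
  have hcomm := P.homologyMap_comp_fromLeftDerivedZero'
    ((tensoringLeft (ModuleCat.{u} R)).map S.f)
  let φ : tensorComplex S.X₁ P.complex ⟶ tensorComplex S.X₂ P.complex := (tensorResolution S P).f
  let T₀ : ShortComplex (ModuleCat.{u} R) :=
    .mk δ (HomologicalComplex.homologyMap φ 0) (hK.δ_comp _ _ hij)
  let T : ShortComplex (ModuleCat.{u} R) := .mk (δ ≫ (e S.X₁).hom) (S.f ▷ Q) (by
    have h : (e S.X₁).hom ≫ S.f ▷ Q = HomologicalComplex.homologyMap φ 0 ≫ (e S.X₂).hom :=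
      hcomm.symm
    rw [Category.assoc, h, ← Category.assoc]
    exact (T₀.zero =≫ (e S.X₂).hom).trans Limits.zero_comp)
  have hT : T.Exact :=
    (ShortComplex.exact_iff_of_iso (S₁ := T₀) (S₂ := T)
      (ShortComplex.isoMk (Iso.refl _) (e S.X₁) (e S.X₂) (Category.id_comp _) hcomm.symm)).mp hex
  have hTm : Mono T.f := mono_comp δ (e S.X₁).hom
  let i := (P.isoLeftDerivedObj ((tensoringLeft (ModuleCat.{u} R)).obj S.X₃) 1).toLinearEquiv
  have hr : LinearMap.range T.f.hom = LinearMap.ker (S.f.hom.rTensor Q) :=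
    hT.moduleCat_range_eq_ker
  exact ⟨i ≪≫ₗ LinearEquiv.ofInjective T.f.hom ((ModuleCat.mono_iff_injective _).mp hTm) ≪≫ₗ
    LinearEquiv.ofEq _ _ hr⟩

theorem exists_shortExact_flat [IsNoetherianRing R] (M : ModuleCat.{u} R) [Module.Finite R M] :
    ∃ (X F : ModuleCat.{u} R) (f : X ⟶ F) (g : F ⟶ M) (w : f ≫ g = 0),
      (ShortComplex.mk f g w).ShortExact ∧ Module.Finite R X ∧ Module.Finite R F ∧
        Module.Flat R F := by
  obtain ⟨k, p, hp⟩ := Module.Finite.exists_fin' R M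
  refine ⟨.of R (LinearMap.ker p), .of R (Fin k → R), ModuleCat.ofHom (LinearMap.ker p).subtype,
    ModuleCat.ofHom p, by ext x; exact x.2, ?_, inferInstance, inferInstance, inferInstance⟩
  refine .mk' ?_ ((ModuleCat.mono_iff_injective _).mpr (LinearMap.ker p).injective_subtype)
    ((ModuleCat.epi_iff_surjective _).mpr hp)
  rw [ShortComplex.moduleCat_exact_iff_ker_sub_range]
  intro x hx
  exact ⟨⟨x, hx⟩, rfl⟩

theorem exists_eventually_associatedPrimes_tor_eq [IsNoetherianRing R] (I : Ideal R)
    (N : Type u) [AddCommGroup N] [Module R N] [Module.Finite R N] (i : ℕ)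
    (M : ModuleCat.{u} R) [Module.Finite R M] :
    ∃ S : Set (Ideal R), ∃ K, ∀ n ≥ K, associatedPrimes R (((Tor (ModuleCat.{u} R) i).obj M).obj
      (ModuleCat.of R (N ⧸ (I ^ n • ⊤ : Submodule R N)))) = S := by
  match i with
  | 0 =>
    obtain ⟨S, K, h⟩ := eventually_associatedPrimes_ker_rTensor_eq (N := N) I
      (0 : M →ₗ[R] M)
    refine ⟨S, K, fun n hn ↦ ?_⟩
    obtain ⟨e⟩ := nonempty_tor_zero_linearEquiv M (.of R (N ⧸ (I ^ n • ⊤ : Submodule R N)))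
    rw [← h n hn, LinearMap.rTensor_zero, LinearMap.ker_zero,
      LinearEquiv.AssociatedPrimes.eq Submodule.topEquiv]
    exact LinearEquiv.AssociatedPrimes.eq e
  | 1 =>
    obtain ⟨X, F, f, g, w, hS, _, _, hF⟩ := exists_shortExact_flat M
    obtain ⟨S, K, h⟩ := eventually_associatedPrimes_ker_rTensor_eq (N := N) I f.hom
    refine ⟨S, K, fun n hn ↦ ?_⟩
    have : Module.Flat R (ShortComplex.mk f g w).X₂ := hF
    obtain ⟨e⟩ := nonempty_tor_one_linearEquiv hS (.of R (N ⧸ (I ^ n • ⊤ : Submodule R N)))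
    rw [← h n hn]
    exact LinearEquiv.AssociatedPrimes.eq e
  | i + 2 =>
    obtain ⟨X, F, f, g, w, hS, _, _, hF⟩ := exists_shortExact_flat M
    obtain ⟨S, K, h⟩ := exists_eventually_associatedPrimes_tor_eq I N (i + 1) X
    refine ⟨S, K, fun n hn ↦ ?_⟩
    have : Module.Flat R (ShortComplex.mk f g w).X₂ := hF
    obtain ⟨e⟩ := nonempty_iso_tor_of_shortExact hS
      (.of R (N ⧸ (I ^ n • ⊤ : Submodule R N))) i
    rw [← h n hn]
    exact LinearEquiv.AssociatedPrimes.eq e.toLinearEquiv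

end



/-- **Melkersson–Schenzel / Katz–West (Tor, special case).** For finitely generated
modules `M`, `N` over a commutative Noetherian ring `R`, an ideal `I` and fixed `i`,
the set of associated primes of `Tor_i^R(M, N/IⁿN)` is independent of `n` for `n ≫ 0`. -/
theorem ass_tor_quotient_power_stable (R : Type) [CommRing R] [IsNoetherianRing R]
    (I : Ideal R) (M N : Type) [AddCommGroup M] [Module R M] [Module.Finite R M]
    [AddCommGroup N] [Module R N] [Module.Finite R N] (i : ℕ) :
    ∃ K : ℕ, ∀ n : ℕ, K ≤ n →
      associatedPrimes R
        (((Tor (ModuleCat R) i).obj (ModuleCat.of R M)).obj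
          (ModuleCat.of R (N ⧸ (I ^ n • (⊤ : Submodule R N))))) =
      associatedPrimes R
        (((Tor (ModuleCat R) i).obj (ModuleCat.of R M)).obj
          (ModuleCat.of R (N ⧸ (I ^ K • (⊤ : Submodule R N))))) := by
  obtain ⟨S, K, h⟩ := exists_eventually_associatedPrimes_tor_eq I N i (.of R M)
  exact ⟨K, fun n hn ↦ (h n hn).trans (h K le_rfl).symm⟩
end

section
/- Let R be a commutative Noetherian ring, I_1,...,I_t ideals, M and N finitely generated R-modules, N' ⊆ N a submodule, and fix i ≥ 0. Then there exists k ∈ ℕ such that Ass_R(Tor_i^R(M, N/(I_1^{n_1}⋯I_t^{n_t}) N')) is the same set for all (n_1,...,n_t) with each n_j ≥ k. -/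
open CategoryTheory

namespace KatzWest

section Noetherian

variable {S E : Type} [CommRing S] [IsNoetherianRing S] [AddCommGroup E] [Module S E]

lemma exists_stable_of_le_fg {N : Submodule S E} (hN : N.FG) (c : ℕ →o Submodule S E)
    (h : ∀ k, c k ≤ N) : ∃ k, ∀ l, k ≤ l → c k = c l := by
  have : IsNoetherian S N := isNoetherian_of_fg_of_noetherian N hN
  obtain ⟨k, hk⟩ := monotone_stabilizes_iff_noetherian.2 this
    ⟨fun k => (c k).submoduleOf N, fun k l hkl => Submodule.comap_mono (c.monotone hkl)⟩
  refine ⟨k, fun l hl => ?_⟩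
  have := congrArg (Submodule.map N.subtype) (hk l hl)
  simpa [Submodule.submoduleOf, Submodule.map_comap_subtype, inf_eq_right.2 (h _)] using this

variable {R : Type} [CommRing R] [Algebra R S]

/-- The primes of `R` which are annihilators of elements of a finite module over a Noetherian
`R`-algebra form a finite set. -/
lemma finite_primes_annihilator [Module.Finite S E] :
    {p : Ideal R | p.IsPrime ∧ ∃ x : E, ∀ r, r ∈ p ↔ algebraMap R S r • x = 0}.Finite := by
  induction ‹Module.Finite S E› using
    IsNoetherianRing.induction_on_isQuotientEquivQuotientPrime S with
  | subsingleton N =>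
    refine Set.finite_empty.subset ?_
    rintro p ⟨hp, x, hx⟩
    exact hp.ne_top ((Ideal.eq_top_iff_one _).2 ((hx 1).2 (Subsingleton.elim _ _)))
  | quotient N q f =>
    refine (Set.finite_singleton (q.1.comap (algebraMap R S))).subset ?_
    rintro p ⟨hp, x, hx⟩
    obtain ⟨y, hy⟩ := Ideal.Quotient.mk_surjective (f x)
    have hyq : y ∉ q.1 := fun h => by
      have h0 : x = 0 := by
        rw [← f.map_eq_zero_iff, ← hy]
        exact Ideal.Quotient.eq_zero_iff_mem.2 h
      exact hp.ne_top ((Ideal.eq_top_iff_one _).2 ((hx 1).2 (by rw [h0, smul_zero])))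
    ext r
    rw [hx, ← f.map_eq_zero_iff, map_smul, ← hy, Algebra.smul_def, Ideal.Quotient.algebraMap_eq,
      ← map_mul, Ideal.Quotient.eq_zero_iff_mem, Ideal.mem_comap]
    exact ⟨fun h => (q.2.mem_or_mem h).resolve_right hyq, fun h => q.1.mul_mem_right _ h⟩
  | exact N₁ N₂ N₃ f g hf _ hfg h₁ h₃ =>
    refine (h₁.union h₃).subset ?_
    rintro p ⟨hp, x, hx⟩
    by_cases h : ∃ r ∉ p, algebraMap R S r • g x = 0
    · obtain ⟨r, hr, hrx⟩ := h
      rw [← map_smul] at hrx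
      obtain ⟨y, hy⟩ := (hfg _).1 hrx
      refine Or.inl ⟨hp, y, fun s => ?_⟩
      rw [← map_eq_zero_iff f hf, map_smul, hy, smul_smul, ← map_mul, ← hx]
      exact ⟨fun hs => p.mul_mem_right _ hs, fun hs => (hp.mem_or_mem hs).resolve_right hr⟩
    · push Not at h
      refine Or.inr ⟨hp, g x, fun s => ⟨fun hs => ?_, fun hs => ?_⟩⟩
      · rw [← map_smul, (hx s).1 hs, map_zero]
      · by_contra hsp
        exact h s hsp hs

lemma finite_primes_colon [Module R E] [IsScalarTower R S E] {N : Submodule S E} (hN : N.FG)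
    (N' : Submodule S E) :
    {p : Ideal R | p.IsPrime ∧ ∃ x ∈ N, ∀ r : R, r ∈ p ↔ r • x ∈ N'}.Finite := by
  have : Module.Finite S N := Module.Finite.iff_fg.2 hN
  refine (finite_primes_annihilator (R := R) (S := S) (E := N ⧸ N'.submoduleOf N)).subset ?_
  rintro p ⟨hp, x, hxN, hx⟩
  refine ⟨hp, Submodule.Quotient.mk ⟨x, hxN⟩, fun r => ?_⟩
  rw [hx, ← Submodule.Quotient.mk_smul, Submodule.Quotient.mk_eq_zero, Submodule.submoduleOf,
    Submodule.mem_comap]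
  simp

end Noetherian

section Rees
open TensorProduct MvPolynomial

variable {R : Type} [CommRing R] {ι : Type} [Fintype ι] (I : ι → Ideal R)

/-- The product of powers `∏ j, I j ^ n j`. -/
def mpow (n : ι →₀ ℕ) : Ideal R := ∏ j, I j ^ n j

lemma mpow_zero : mpow I 0 = ⊤ := by simp [mpow, Ideal.one_eq_top]

lemma mpow_add (n m : ι →₀ ℕ) : mpow I (n + m) = mpow I n * mpow I m := by
  simp [mpow, pow_add, Finset.prod_mul_distrib]

lemma mpow_single (j : ι) : mpow I (Finsupp.single j 1) = I j := by
  classical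
  rw [mpow, Finset.prod_eq_single j]
  · simp
  · intro b _ hb
    simp [Finsupp.single_eq_of_ne hb]
  · simp

lemma mpow_anti {n m : ι →₀ ℕ} (h : n ≤ m) : mpow I m ≤ mpow I n := by
  rw [← add_tsub_cancel_of_le h, mpow_add]
  exact Ideal.mul_le_left (I := mpow I n)

/-- The multigraded Rees algebra of the ideals `I j`. -/
noncomputable def multiRees : Subalgebra R (MvPolynomial ι R) :=
  Algebra.adjoin R {q | ∃ j, ∃ a ∈ I j, q = monomial (Finsupp.single j 1) a}

lemma multiRees_fg [IsNoetherianRing R] : (multiRees I).FG := by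
  classical
  have hfg : ∀ j, ∃ s : Finset R, Ideal.span (s : Set R) = I j := fun j =>
    (isNoetherianRing_iff_ideal_fg R).1 ‹_› (I j)
  choose s hs using hfg
  let T : Finset (MvPolynomial ι R) :=
    Finset.univ.biUnion fun j => (s j).image (monomial (Finsupp.single j 1))
  refine ⟨T, le_antisymm (Algebra.adjoin_mono ?_) (Algebra.adjoin_le ?_)⟩
  · intro q hq
    simp only [T, Finset.coe_biUnion, Finset.coe_image, Set.mem_iUnion, Set.mem_image] at hq
    obtain ⟨j, -, a, ha, rfl⟩ := hq
    exact ⟨j, a, hs j ▸ Ideal.subset_span ha, rfl⟩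
  · rintro q ⟨j, a, ha, rfl⟩
    have h : I j ≤ (Subalgebra.toSubmodule (Algebra.adjoin R (T : Set (MvPolynomial ι R)))).comap
        (monomial (Finsupp.single j 1)) := by
      rw [← hs j]
      refine Submodule.span_le.2 fun b hb => Algebra.subset_adjoin ?_
      simp only [T, Finset.coe_biUnion, Finset.coe_image, Set.mem_iUnion, Set.mem_image]
      exact ⟨j, Finset.mem_coe.2 (Finset.mem_univ j), b, hb, rfl⟩
    exact h ha

instance [IsNoetherianRing R] : IsNoetherianRing (multiRees I) :=
  isNoetherianRing_of_fg (multiRees_fg I)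

omit [Fintype ι] in
lemma finsupp_induction_add_single_one {motive : (ι →₀ ℕ) → Prop} (n : ι →₀ ℕ)
    (zero : motive 0) (add_single : ∀ n j, motive n → motive (n + Finsupp.single j 1)) :
    motive n := by
  induction hd : n.degree generalizing n with
  | zero => rwa [(Finsupp.degree_eq_zero_iff n).1 hd]
  | succ d ih =>
    have hn : n ≠ 0 := by
      rintro rfl
      simp at hd
    obtain ⟨j, hj⟩ := Finsupp.ne_iff.1 hn
    have hle : Finsupp.single j 1 ≤ n :=
      Finsupp.single_le_iff.2 (Nat.one_le_iff_ne_zero.2 hj)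
    have h := add_single (n - Finsupp.single j 1) j (ih _ ?_)
    · rwa [tsub_add_cancel_of_le hle] at h
    · have := congrArg Finsupp.degree (tsub_add_cancel_of_le hle)
      rw [map_add, hd, Finsupp.degree_single] at this
      omega

lemma monomial_mem_multiRees {n : ι →₀ ℕ} {a : R} (ha : a ∈ mpow I n) :
    monomial n a ∈ multiRees I := by
  classical
  induction n using finsupp_induction_add_single_one generalizing a with
  | zero => exact (multiRees I).algebraMap_mem a
  | add_single n j h =>
    rw [mpow_add, mpow_single] at ha
    refine Submodule.mul_induction_on ha (fun x hx y hy => ?_) (fun x y hx hy => ?_)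
    · rw [← monomial_mul]
      exact mul_mem (h hx) (Algebra.subset_adjoin ⟨j, y, hy, rfl⟩)
    · rw [map_add]
      exact add_mem hx hy

variable {B : Type} [AddCommGroup B] [Module R B]

/-- The coefficient of degree `n` of an element of `B[X]`. -/
noncomputable def tcoeff (n : ι →₀ ℕ) : MvPolynomial ι R ⊗[R] B →ₗ[R] B :=
  (TensorProduct.lid R B).toLinearMap ∘ₗ LinearMap.rTensor B (lcoeff R n)

omit [Fintype ι] in
@[simp] lemma tcoeff_tmul (n : ι →₀ ℕ) (q : MvPolynomial ι R) (b : B) :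
    tcoeff n (q ⊗ₜ[R] b) = coeff n q • b := by
  simp [tcoeff]

omit [Fintype ι] in
lemma tcoeff_monomial_smul (n m : ι →₀ ℕ) (a : R) (f : MvPolynomial ι R ⊗[R] B) :
    tcoeff n (monomial m a • f) = if m ≤ n then a • tcoeff (n - m) f else 0 := by
  induction f with
  | zero => simp
  | tmul q b =>
    rw [TensorProduct.smul_tmul', tcoeff_tmul, smul_eq_mul, coeff_monomial_mul']
    split_ifs <;> simp [mul_smul]
  | add f g hf hg =>
    rw [smul_add, map_add, hf, hg]
    split_ifs <;> simp

omit [Fintype ι] in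
lemma exists_sum_tcoeff (f : MvPolynomial ι R ⊗[R] B) :
    ∃ s : Finset (ι →₀ ℕ), ∀ s', s ⊆ s' → ∑ n ∈ s', monomial n (1 : R) ⊗ₜ[R] tcoeff n f = f := by
  classical
  induction f with
  | zero => exact ⟨∅, fun s' _ => by simp⟩
  | tmul q b =>
    refine ⟨q.support, fun s' hs => ?_⟩
    conv_rhs => rw [q.as_sum, TensorProduct.sum_tmul]
    rw [← Finset.sum_subset hs]
    · refine Finset.sum_congr rfl fun n _ => ?_
      rw [tcoeff_tmul, ← TensorProduct.smul_tmul, smul_monomial, smul_eq_mul, mul_one]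
    · intro n _ hn
      simp [notMem_support_iff.1 hn]
  | add f g hf hg =>
    obtain ⟨s, hs⟩ := hf
    obtain ⟨u, hu⟩ := hg
    refine ⟨s ∪ u, fun s' h => ?_⟩
    simp only [map_add, TensorProduct.tmul_add, Finset.sum_add_distrib]
    rw [hs s' (Finset.union_subset_left h), hu s' (Finset.union_subset_right h)]

/-- A family of submodules compatible with multiplication by the ideals `mpow I m`. -/
def IsGradedFamily (V : (ι →₀ ℕ) → Submodule R B) : Prop :=
  ∀ n m, mpow I m • V n ≤ V (n + m)

variable {I}

/-- The module over the multigraded Rees algebra attached to a graded family of submodules. -/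
noncomputable def IsGradedFamily.toSubmodule {V : (ι →₀ ℕ) → Submodule R B}
    (hV : IsGradedFamily I V) : Submodule (multiRees I) (MvPolynomial ι R ⊗[R] B) where
  carrier := {f | ∀ n, tcoeff n f ∈ V n}
  zero_mem' n := by simp
  add_mem' {f g} hf hg n := by
    rw [map_add]
    exact add_mem (hf n) (hg n)
  smul_mem' := by
    rintro ⟨q, hq⟩ f hf
    change ∀ n, tcoeff n (q • f) ∈ V n
    induction hq using Algebra.adjoin_induction generalizing f with
    | mem q hq =>
      obtain ⟨j, a, ha, rfl⟩ := hq
      intro n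
      rw [tcoeff_monomial_smul]
      split_ifs with h
      · have := hV (n - Finsupp.single j 1) (Finsupp.single j 1)
        rw [mpow_single, tsub_add_cancel_of_le h] at this
        exact this (Submodule.smul_mem_smul ha (hf _))
      · exact zero_mem _
    | algebraMap r =>
      intro n
      rw [algebraMap_smul, map_smul]
      exact Submodule.smul_mem _ _ (hf n)
    | add x y _ _ hx hy =>
      intro n
      rw [add_smul, map_add]
      exact add_mem (hx hf n) (hy hf n)
    | mul x y _ _ hx hy =>
      rw [mul_smul]
      exact hx (hy hf)

lemma IsGradedFamily.mem_toSubmodule {V : (ι →₀ ℕ) → Submodule R B} (hV : IsGradedFamily I V)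
    {f : MvPolynomial ι R ⊗[R] B} : f ∈ hV.toSubmodule ↔ ∀ n, tcoeff n f ∈ V n := Iff.rfl

lemma IsGradedFamily.monomial_tmul_mem_toSubmodule {V : (ι →₀ ℕ) → Submodule R B}
    (hV : IsGradedFamily I V) {n : ι →₀ ℕ} {v : B} :
    monomial n (1 : R) ⊗ₜ[R] v ∈ hV.toSubmodule ↔ v ∈ V n := by
  classical
  refine ⟨fun h => by simpa using h n, fun h m => ?_⟩
  rw [tcoeff_tmul, coeff_monomial]
  split_ifs with hnm
  · subst hnm
    simpa using h
  · simp

lemma IsGradedFamily.toSubmodule_mono {V W : (ι →₀ ℕ) → Submodule R B} (hV : IsGradedFamily I V)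
    (hW : IsGradedFamily I W) (h : V ≤ W) : hV.toSubmodule ≤ hW.toSubmodule :=
  fun _ hf n => h n (hf n)

variable (I) in
/-- The submodule of `B[X]` generated over the Rees algebra by a submodule of constants. -/
noncomputable def constSpan (B' : Submodule R B) :
    Submodule (multiRees I) (MvPolynomial ι R ⊗[R] B) :=
  Submodule.span _ ((TensorProduct.mk R (MvPolynomial ι R) B 1) '' (B' : Set B))

omit [Fintype ι] in
lemma constSpan_fg {B' : Submodule R B} (hB' : B'.FG) : (constSpan I B').FG := by
  classical
  obtain ⟨s, rfl⟩ := hB'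
  refine ⟨s.image (TensorProduct.mk R (MvPolynomial ι R) B 1), le_antisymm ?_ ?_⟩
  · rw [Finset.coe_image]
    exact Submodule.span_mono (Set.image_mono Submodule.subset_span)
  · refine Submodule.span_le.2 ?_
    rintro _ ⟨b, hb, rfl⟩
    have : Submodule.span R (s : Set B) ≤
        ((Submodule.span (multiRees I) ((s.image (TensorProduct.mk R (MvPolynomial ι R) B 1) :
          Finset _) : Set (MvPolynomial ι R ⊗[R] B))).restrictScalars R).comap
          (TensorProduct.mk R (MvPolynomial ι R) B 1) := by
      refine Submodule.span_le.2 fun x hx => Submodule.subset_span ?_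
      rw [Finset.coe_image]
      exact ⟨x, hx, rfl⟩
    exact this hb

lemma IsGradedFamily.toSubmodule_le_constSpan {V : (ι →₀ ℕ) → Submodule R B}
    (hV : IsGradedFamily I V) {B' : Submodule R B} (h : ∀ n, V n ≤ mpow I n • B') :
    hV.toSubmodule ≤ constSpan I B' := by
  intro f hf
  obtain ⟨s, hs⟩ := exists_sum_tcoeff f
  rw [← hs s subset_rfl]
  refine Submodule.sum_mem _ fun n _ => ?_
  refine Submodule.smul_induction_on (h n (hf n)) (fun a ha b hb => ?_) (fun x y hx hy => ?_)
  · have : monomial n (1 : R) ⊗ₜ[R] (a • b) =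
        (⟨monomial n a, monomial_mem_multiRees I ha⟩ : multiRees I) •
          (TensorProduct.mk R (MvPolynomial ι R) B 1 b) := by
      rw [Subalgebra.smul_def, TensorProduct.mk_apply, TensorProduct.smul_tmul',
        ← TensorProduct.smul_tmul, smul_monomial]
      simp
    rw [this]
    exact Submodule.smul_mem _ _ (Submodule.subset_span ⟨b, hb, rfl⟩)
  · rw [TensorProduct.tmul_add]
    exact add_mem hx hy

/-- Ascending chains of graded families of submodules of `mpow I n • B'` stabilize. -/
lemma exists_stable_of_monotone [IsNoetherianRing R] {B' : Submodule R B} (hB' : B'.FG)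
    (W : ℕ →o ((ι →₀ ℕ) → Submodule R B)) (hW : ∀ k, IsGradedFamily I (W k))
    (h : ∀ k n, W k n ≤ mpow I n • B') : ∃ k, ∀ l, k ≤ l → W k = W l := by
  obtain ⟨k, hk⟩ := exists_stable_of_le_fg (constSpan_fg (I := I) hB')
    ⟨fun k => (hW k).toSubmodule, fun k l hkl =>
      (hW k).toSubmodule_mono (hW l) (W.monotone hkl)⟩
    fun k => (hW k).toSubmodule_le_constSpan (h k)
  refine ⟨k, fun l hl => le_antisymm (W.monotone hl) fun n v hv => ?_⟩
  have h1 := ((hW l).monomial_tmul_mem_toSubmodule).2 hv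
  have h2 : (hW k).toSubmodule = (hW l).toSubmodule := hk l hl
  rw [← h2] at h1
  exact ((hW k).monomial_tmul_mem_toSubmodule).1 h1

/-- Multigraded Artin–Rees: a graded family below `mpow I n • B'` is eventually generated by
multiplication with the ideals. -/
theorem exists_generation [IsNoetherianRing R] {B' : Submodule R B} (hB' : B'.FG)
    {V : (ι →₀ ℕ) → Submodule R B} (hV : IsGradedFamily I V) (h : ∀ n, V n ≤ mpow I n • B') :
    ∃ k : ι →₀ ℕ, ∀ n m, k ≤ n → V (n + m) = mpow I m • V n := by
  let W : ℕ →o ((ι →₀ ℕ) → Submodule R B) :=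
    ⟨fun k n => ⨆ d, ⨆ (_ : d ≤ n ∧ ∀ j, d j ≤ k), mpow I (n - d) • V d,
      fun k l hkl n => iSup₂_le fun d hd => le_iSup₂_of_le d ⟨hd.1, fun j => (hd.2 j).trans hkl⟩
        le_rfl⟩
  have hWapp : ∀ k n, W k n = ⨆ d, ⨆ (_ : d ≤ n ∧ ∀ j, d j ≤ k), mpow I (n - d) • V d :=
    fun _ _ => rfl
  have hWV : ∀ k n, W k n ≤ V n := fun k n => iSup₂_le fun d hd => by
    have := hV d (n - d)
    rwa [add_tsub_cancel_of_le hd.1] at this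
  have hW : ∀ k, IsGradedFamily I (W k) := by
    intro k n m
    rw [hWapp, hWapp, Submodule.smul_iSup]
    refine iSup_le fun d => ?_
    rw [Submodule.smul_iSup]
    refine iSup_le fun hd => ?_
    refine le_iSup₂_of_le d ⟨hd.1.trans le_self_add, hd.2⟩ ?_
    rw [← Submodule.mul_smul, ← mpow_add, add_comm n m, add_tsub_assoc_of_le hd.1]
  obtain ⟨K, hK⟩ := exists_stable_of_monotone hB' W hW fun k n => (hWV k n).trans (h n)
  refine ⟨Finsupp.equivFunOnFinite.symm fun _ => K, fun n m hn => le_antisymm ?_ (hV n m)⟩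
  have h1 : V (n + m) ≤ W (max K ((n + m).degree)) (n + m) := by
    rw [hWapp]
    refine le_iSup₂_of_le (n + m) ⟨le_rfl, fun j => (Finsupp.le_degree j _).trans
      (le_max_right _ _)⟩ ?_
    rw [tsub_self, mpow_zero, Submodule.top_smul]
  rw [← hK _ (le_max_left _ _), hWapp] at h1
  refine h1.trans (iSup₂_le fun d hd => ?_)
  have hdn : d ≤ n := fun j => (hd.2 j).trans (hn j)
  rw [add_comm n m, add_tsub_assoc_of_le hdn, mpow_add, Submodule.mul_smul]
  refine Submodule.smul_mono le_rfl ?_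
  have := hV d (n - d)
  rwa [add_tsub_cancel_of_le hdn] at this

lemma finite_primes_colon_mpow [IsNoetherianRing R] {B' : Submodule R B} (hB' : B'.FG)
    (hB : (⊤ : Submodule R B).FG) :
    {p : Ideal R | p.IsPrime ∧ ∃ n, ∃ u : B, ∀ r : R, r ∈ p ↔ r • u ∈ mpow I n • B'}.Finite := by
  have hV : IsGradedFamily I fun n => mpow I n • B' := fun n m => by
    rw [← Submodule.mul_smul, ← mpow_add, add_comm]
  have hV' : ∀ j, IsGradedFamily I fun n => mpow I (n + Finsupp.single j 1) • B' :=
    fun j n m => by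
      rw [← Submodule.mul_smul, ← mpow_add, add_comm m, add_right_comm]
  have hfg : hV.toSubmodule.FG := by
    have := isNoetherian_of_fg_of_noetherian _ (constSpan_fg (I := I) hB')
    rw [isNoetherian_submodule] at this
    exact this _ (hV.toSubmodule_le_constSpan fun n => le_rfl)
  have hfin := (finite_primes_colon (R := R) hB B').union
    (Set.finite_iUnion fun j => finite_primes_colon (R := R) hfg (hV' j).toSubmodule)
  refine hfin.subset ?_
  rintro p ⟨hp, n, hn⟩
  induction n using finsupp_induction_add_single_one with
  | zero =>
    obtain ⟨u, hu⟩ := hn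
    simp only [mpow_zero, Submodule.top_smul] at hu
    exact Or.inl ⟨hp, u, trivial, hu⟩
  | add_single n j ih =>
    obtain ⟨u, hu⟩ := hn
    by_cases h : ∃ r ∉ p, r • u ∈ mpow I n • B'
    · obtain ⟨r, hr, hru⟩ := h
      refine Or.inr (Set.mem_iUnion.2 ⟨j, hp, monomial n (1 : R) ⊗ₜ[R] (r • u),
        hV.monomial_tmul_mem_toSubmodule.2 hru, fun s => ?_⟩)
      rw [← TensorProduct.tmul_smul, (hV' j).monomial_tmul_mem_toSubmodule, smul_smul, ← hu]
      exact ⟨fun hs => p.mul_mem_right _ hs, fun hs => (hp.mem_or_mem hs).resolve_right hr⟩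
    · push Not at h
      refine ih ⟨u, fun r => ⟨fun hr => ?_, fun hr => ?_⟩⟩
      · exact Submodule.smul_mono (mpow_anti I le_self_add) le_rfl ((hu r).1 hr)
      · by_contra hrp
        exact h r hrp hr

/-! ### Eventual constancy -/

open Filter

omit [Fintype ι] in
lemma eventually_or_of_monotone {P : (ι →₀ ℕ) → Prop} {k : ι →₀ ℕ}
    (h : ∀ n m, k ≤ n → P n → P (n + m)) :
    (∀ᶠ n in atTop, P n) ∨ ∀ᶠ n in atTop, ¬ P n := by
  by_cases hex : ∃ n, k ≤ n ∧ P n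
  · obtain ⟨n, hn, hP⟩ := hex
    refine Or.inl ((eventually_ge_atTop n).mono fun m hm => ?_)
    rw [← add_tsub_cancel_of_le hm]
    exact h n _ hn hP
  · push Not at hex
    exact Or.inr ((eventually_ge_atTop k).mono hex)

variable {A : Type} [AddCommGroup A] [Module R A]

lemma eventually_saturated_or_not [IsNoetherianRing R] (f : A →ₗ[R] B) {A' : Submodule R A}
    {B' : Submodule R B} (hB' : B'.FG) (p : Ideal R) [hp : p.IsPrime] :
    (∀ᶠ n in atTop, ∀ u, f u ∈ mpow I n • B' → ∃ s ∉ p, s • u ∈ mpow I n • A') ∨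
      ∀ᶠ n in atTop, ¬ ∀ u, f u ∈ mpow I n • B' → ∃ s ∉ p, s • u ∈ mpow I n • A' := by
  let V : (ι →₀ ℕ) → Submodule R B := fun n => LinearMap.range f ⊓ mpow I n • B'
  have hV : IsGradedFamily I V := fun n m => le_inf
    ((Submodule.smul_mono le_rfl inf_le_left).trans Submodule.smul_le_right)
    ((Submodule.smul_mono le_rfl inf_le_right).trans (by
      rw [← Submodule.mul_smul, ← mpow_add, add_comm]))
  obtain ⟨k, hk⟩ := exists_generation hB' hV fun n => inf_le_right
  let sat (C : Submodule R B) (n : ι →₀ ℕ) : Submodule R B :=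
    { carrier := {w | ∃ s ∉ p, s • w ∈ mpow I n • C}
      zero_mem' := ⟨1, fun h => hp.ne_top ((Ideal.eq_top_iff_one _).2 h), by simp⟩
      add_mem' := by
        rintro x y ⟨s, hs, hx⟩ ⟨t, ht, hy⟩
        refine ⟨s * t, fun h => (hp.mem_or_mem h).elim hs ht, ?_⟩
        rw [smul_add]
        refine add_mem ?_ ?_
        · rw [mul_comm, mul_smul]
          exact Submodule.smul_mem _ _ hx
        · rw [mul_smul]
          exact Submodule.smul_mem _ _ hy
      smul_mem' := by
        rintro r x ⟨s, hs, hx⟩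
        refine ⟨s, hs, ?_⟩
        rw [smul_comm]
        exact Submodule.smul_mem _ _ hx }
  have hW := eventually_or_of_monotone (P := fun n => V n ≤ sat (A'.map f) n) (k := k) (by
    intro n m hn h
    rw [hk n m hn, Submodule.smul_le]
    intro r hr x hx
    obtain ⟨s, hs, hsx⟩ := h hx
    refine ⟨s, hs, ?_⟩
    rw [smul_comm, add_comm, mpow_add, Submodule.mul_smul]
    exact Submodule.smul_mem_smul hr hsx)
  have hZ := eventually_or_of_monotone (k := 0)
    (P := fun n => ¬ ∀ z, f z = 0 → ∃ s ∉ p, s • z ∈ mpow I n • A') (by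
    intro n m _ h h'
    refine h fun z hz => ?_
    obtain ⟨s, hs, hsz⟩ := h' z hz
    exact ⟨s, hs, Submodule.smul_mono (mpow_anti I le_self_add) le_rfl hsz⟩)
  have key : ∀ n, (∀ u, f u ∈ mpow I n • B' → ∃ s ∉ p, s • u ∈ mpow I n • A') ↔
      V n ≤ sat (A'.map f) n ∧ ∀ z, f z = 0 → ∃ s ∉ p, s • z ∈ mpow I n • A' := by
    refine fun n => ⟨fun h => ⟨?_, fun z hz => h z (by rw [hz]; exact zero_mem _)⟩, ?_⟩
    · rintro _ ⟨⟨u, rfl⟩, hu⟩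
      obtain ⟨s, hs, hsu⟩ := h u hu
      refine ⟨s, hs, ?_⟩
      rw [← Submodule.map_smul'', ← map_smul]
      exact Submodule.mem_map_of_mem hsu
    · rintro ⟨h1, h2⟩ u hu
      obtain ⟨s, hs, hsu⟩ := h1 (⟨⟨u, rfl⟩, hu⟩ : f u ∈ V n)
      rw [← Submodule.map_smul''] at hsu
      obtain ⟨a, ha, hau⟩ := hsu
      obtain ⟨s', hs', h3⟩ := h2 (s • u - a) (by rw [map_sub, map_smul, hau, sub_self])
      refine ⟨s' * s, fun h => (hp.mem_or_mem h).elim hs' hs, ?_⟩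
      rw [smul_sub] at h3
      have := add_mem h3 (Submodule.smul_mem _ s' ha)
      rwa [sub_add_cancel, smul_smul] at this
  simp only [key]
  rcases hW with hW | hW
  · rcases hZ with hZ | hZ
    · exact Or.inr (hZ.mono fun n h h' => h h'.2)
    · exact Or.inl ((hW.and hZ).mono fun n h => ⟨h.1, not_not.1 h.2⟩)
  · exact Or.inr (hW.mono fun n h h' => h h'.1)

omit [Fintype ι] in
lemma smul_pi_eq {κ : Type} [Finite κ] (J : Ideal R) (A' : Submodule R A) :
    J • Submodule.pi Set.univ (fun _ : κ => A') = Submodule.pi Set.univ fun _ => J • A' := by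
  classical
  have := Fintype.ofFinite κ
  refine le_antisymm (Submodule.smul_le.2 fun r hr x hx i _ =>
    Submodule.smul_mem_smul hr (hx i trivial)) fun x hx => ?_
  rw [← Finset.univ_sum_single x]
  refine Submodule.sum_mem _ fun i _ => ?_
  have h : (J • A').map (LinearMap.single R (fun _ : κ => A) i) ≤
      J • Submodule.pi Set.univ (fun _ : κ => A') := by
    rw [Submodule.map_smul'']
    refine Submodule.smul_mono le_rfl ?_
    rintro _ ⟨a, ha, rfl⟩ j _
    by_cases hj : j = i
    · subst hj
      simpa using ha
    · simp [hj]
  exact h (Submodule.mem_map_of_mem (hx i trivial))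

omit [Fintype ι] in
lemma smul_prod_eq (J : Ideal R) (A' : Submodule R A) (B' : Submodule R B) :
    J • A'.prod B' = (J • A').prod (J • B') := by
  refine le_antisymm (Submodule.smul_le.2 fun r hr x hx =>
    ⟨Submodule.smul_mem_smul hr hx.1, Submodule.smul_mem_smul hr hx.2⟩) ?_
  rintro ⟨a, b⟩ ⟨ha, hb⟩
  have h1 : (J • A').map (LinearMap.inl R A B) ≤ J • A'.prod B' := by
    rw [Submodule.map_smul'']
    refine Submodule.smul_mono le_rfl ?_
    rintro _ ⟨a, ha, rfl⟩
    exact ⟨ha, zero_mem _⟩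
  have h2 : (J • B').map (LinearMap.inr R A B) ≤ J • A'.prod B' := by
    rw [Submodule.map_smul'']
    refine Submodule.smul_mono le_rfl ?_
    rintro _ ⟨a, ha, rfl⟩
    exact ⟨zero_mem _, ha⟩
  simpa using add_mem (h1 (Submodule.mem_map_of_mem ha)) (h2 (Submodule.mem_map_of_mem hb))

lemma eventually_prime_colon_or_not [IsNoetherianRing R] (f : A →ₗ[R] B) {A' : Submodule R A}
    {B' : Submodule R B} (hA' : A'.FG) (hB' : B'.FG) (p : Ideal R)
    [hp : p.IsPrime] :
    (∀ᶠ n in atTop, ∃ u, f u ∈ mpow I n • B' ∧ ∀ r : R, r ∈ p ↔ r • u ∈ mpow I n • A') ∨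
      ∀ᶠ n in atTop, ¬ ∃ u, f u ∈ mpow I n • B' ∧ ∀ r : R, r ∈ p ↔ r • u ∈ mpow I n • A' := by
  obtain ⟨k, x, hx⟩ := Submodule.fg_iff_exists_fin_generating_family.1
    ((isNoetherianRing_iff_ideal_fg R).1 ‹_› p)
  let g : A →ₗ[R] B × (Fin k → A) := f.prod (LinearMap.pi fun i => x i • LinearMap.id)
  have key : ∀ n, (∃ u, f u ∈ mpow I n • B' ∧ ∀ r : R, r ∈ p ↔ r • u ∈ mpow I n • A') ↔
      ¬ ∀ u, g u ∈ mpow I n • B'.prod (Submodule.pi Set.univ fun _ => A') →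
        ∃ s ∉ p, s • u ∈ mpow I n • A' := by
    intro n
    rw [smul_prod_eq, smul_pi_eq]
    push Not
    refine exists_congr fun u => ?_
    have hmem : g u ∈ (mpow I n • B').prod (Submodule.pi Set.univ fun _ => mpow I n • A') ↔
        f u ∈ mpow I n • B' ∧ ∀ r ∈ p, r • u ∈ mpow I n • A' := by
      have : (∀ r ∈ p, r • u ∈ mpow I n • A') ↔ ∀ i, x i • u ∈ mpow I n • A' := by
        refine ⟨fun h i => h _ (hx ▸ Submodule.subset_span ⟨i, rfl⟩), fun h => ?_⟩
        have hle : p ≤ (mpow I n • A').comap (LinearMap.toSpanSingleton R A u) := by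
          rw [← hx, Submodule.span_le]
          rintro _ ⟨i, rfl⟩
          exact h i
        exact fun r hr => hle hr
      rw [this]
      simp [g, Submodule.mem_prod, Submodule.mem_pi]
    rw [hmem]
    refine ⟨fun ⟨h1, h2⟩ => ⟨⟨h1, fun r hr => (h2 r).1 hr⟩, fun s hs h => hs ((h2 s).2 h)⟩,
      fun ⟨⟨h1, h2⟩, h3⟩ => ⟨h1, fun r => ⟨h2 r, fun h => ?_⟩⟩⟩
    by_contra hr
    exact h3 r hr h
  simp only [key, not_not]
  exact (eventually_saturated_or_not g (hB'.prod (Submodule.fg_pi fun _ => hA')) p).symm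

/-- The set of primes which are annihilators in the subquotient
`f⁻¹(mpow I n • B') / mpow I n • A'` is eventually constant. -/
theorem eventually_forall_prime_colon_iff [IsNoetherianRing R] [Module.Finite R A]
    (f : A →ₗ[R] B) {A' : Submodule R A} {B' : Submodule R B} (hB' : B'.FG) :
    ∃ T : Set (Ideal R), ∀ᶠ n in atTop, ∀ p : Ideal R, (p.IsPrime ∧
      ∃ u, f u ∈ mpow I n • B' ∧ ∀ r : R, r ∈ p ↔ r • u ∈ mpow I n • A') ↔ p ∈ T := by
  have hA' : A'.FG := IsNoetherian.noetherian A'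
  have hfin := finite_primes_colon_mpow (I := I) hA' (Module.Finite.fg_top)
  let T : Set (Ideal R) := {p | p.IsPrime ∧ ∀ᶠ n in atTop,
    ∃ u, f u ∈ mpow I n • B' ∧ ∀ r : R, r ∈ p ↔ r • u ∈ mpow I n • A'}
  have hT : T ⊆ {p : Ideal R | p.IsPrime ∧ ∃ n, ∃ u : A, ∀ r : R, r ∈ p ↔
      r • u ∈ mpow I n • A'} := by
    rintro p ⟨hp, h⟩
    obtain ⟨n, u, -, hu⟩ := h.exists
    exact ⟨hp, n, u, hu⟩
  refine ⟨T, ?_⟩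
  have h := (eventually_all_finite (l := (atTop : Filter (ι →₀ ℕ)))
    (p := fun p n => (∃ u, f u ∈ mpow I n • B' ∧ ∀ r : R, r ∈ p ↔ r • u ∈ mpow I n • A') ↔ p ∈ T)
    hfin).2 (by
    rintro p ⟨hp, -⟩
    rcases eventually_prime_colon_or_not (I := I) f hA' hB' p with h | h
    · have hpT : p ∈ T := ⟨hp, h⟩
      exact h.mono fun n hn => iff_of_true hn hpT
    · have hpT : p ∉ T := fun hpT => by
        obtain ⟨n, h1, h2⟩ := (h.and hpT.2).exists
        exact h1 h2
      exact h.mono fun n hn => iff_of_false hn hpT)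
  refine h.mono fun n hn p => ⟨fun ⟨hp, u, hu⟩ => ?_, fun hp => ?_⟩
  · exact (hn p ⟨hp, n, u, hu.2⟩).1 ⟨u, hu⟩
  · exact ⟨hp.1, (hn p (hT hp)).2 hp⟩

end Rees

section Tor
open MonoidalCategory Limits

variable {R : Type} [CommRing R]

/-- The complex `M ⊗ P` for a complex `P`. -/
noncomputable abbrev tensorComplex (M : ModuleCat.{0} R) (P : ChainComplex (ModuleCat.{0} R) ℕ) :
    ChainComplex (ModuleCat.{0} R) ℕ :=
  (((tensoringLeft (ModuleCat.{0} R)).obj M).mapHomologicalComplex _).obj P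

/-- The map `M ⊗ P ⟶ N ⊗ P` induced by `f : M ⟶ N`. -/
noncomputable abbrev tensorComplexMap {M N : ModuleCat.{0} R} (f : M ⟶ N)
    (P : ChainComplex (ModuleCat.{0} R) ℕ) : tensorComplex M P ⟶ tensorComplex N P :=
  (NatTrans.mapHomologicalComplex ((tensoringLeft (ModuleCat.{0} R)).map f) _).app P

/-- The short complex of complexes obtained by tensoring `S` with `P`. -/
noncomputable def tensorShortComplex (S : ShortComplex (ModuleCat.{0} R))
    (P : ChainComplex (ModuleCat.{0} R) ℕ) : ShortComplex (ChainComplex (ModuleCat.{0} R) ℕ) :=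
  ShortComplex.mk (tensorComplexMap S.f P) (tensorComplexMap S.g P) (by
    ext n : 1
    change (S.f ▷ P.X n) ≫ (S.g ▷ P.X n) = 0
    rw [← MonoidalCategory.comp_whiskerRight, S.zero]
    exact (tensorRight (P.X n)).map_zero _ _)

lemma tensorShortComplex_shortExact {S : ShortComplex (ModuleCat.{0} R)} (hS : S.ShortExact)
    {X : ModuleCat.{0} R} (P : ProjectiveResolution X) :
    (tensorShortComplex S P.complex).ShortExact := by
  refine HomologicalComplex.shortExact_of_degreewise_shortExact _ fun n => ?_
  have : Projective (P.complex.X n) := P.projective n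
  have : Module.Projective R (P.complex.X n) :=
    (IsProjective.iff_projective (P.complex.X n)).mpr ‹_›
  exact hS.map_of_exact (tensorRight (P.complex.X n))

lemma isZero_homology_succ_tensorComplex (M : ModuleCat.{0} R) [Module.Flat R M]
    {X : ModuleCat.{0} R} (P : ProjectiveResolution X) (n : ℕ) :
    IsZero ((tensorComplex M P.complex).homology (n + 1)) := by
  rw [← HomologicalComplex.exactAt_iff_isZero_homology,
    HomologicalComplex.exactAt_iff' _ (n + 2) (n + 1) n (by simp) (by simp),
    ShortComplex.ShortExact.moduleCat_exact_iff_function_exact]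
  have h := P.complex_exactAt_succ n
  rw [HomologicalComplex.exactAt_iff' _ (n + 2) (n + 1) n (by simp) (by simp),
    ShortComplex.ShortExact.moduleCat_exact_iff_function_exact] at h
  have h2 := Module.Flat.lTensor_exact M h
  exact h2

/-- `Tor` computed from a projective resolution of the second variable. -/
noncomputable def torIso (M X : ModuleCat.{0} R) (P : ProjectiveResolution X) (n : ℕ) :
    ((Tor (ModuleCat.{0} R) n).obj M).obj X ≅ (tensorComplex M P.complex).homology n :=
  P.isoLeftDerivedObj ((tensoringLeft (ModuleCat.{0} R)).obj M) n

/-- Dimension shifting in the first variable. -/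
noncomputable def torSuccSuccIso {S : ShortComplex (ModuleCat.{0} R)} (hS : S.ShortExact)
    [Module.Flat R S.X₂] (X : ModuleCat.{0} R) (n : ℕ) :
    ((Tor (ModuleCat.{0} R) (n + 2)).obj S.X₃).obj X ≅
      ((Tor (ModuleCat.{0} R) (n + 1)).obj S.X₁).obj X :=
  let P := projectiveResolution X
  torIso S.X₃ X P (n + 2) ≪≫ (tensorShortComplex_shortExact hS P).δIso (n + 2) (n + 1) rfl
    (isZero_homology_succ_tensorComplex S.X₂ P (n + 1))
    (isZero_homology_succ_tensorComplex S.X₂ P n) ≪≫ (torIso S.X₁ X P (n + 1)).symm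

instance (M : ModuleCat.{0} R) :
    PreservesFiniteColimits ((tensoringLeft (ModuleCat.{0} R)).obj M) :=
  inferInstanceAs (PreservesFiniteColimits (tensorLeft M))

/-- `Tor₀` is the tensor product. -/
noncomputable def torZeroIso (M X : ModuleCat.{0} R) :
    ((Tor (ModuleCat.{0} R) 0).obj M).obj X ≅ M ⊗ X :=
  ((tensoringLeft (ModuleCat.{0} R)).obj M).leftDerivedZeroIsoSelf.app X

/-- The homology of `M ⊗ P` in degree `0` is `M ⊗ X`. -/
noncomputable def homologyZeroIso (M : ModuleCat.{0} R) {X : ModuleCat.{0} R}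
    (P : ProjectiveResolution X) : (tensorComplex M P.complex).homology 0 ≅ M ⊗ X :=
  ChainComplex.isoHomologyι₀ (tensorComplex M P.complex) ≪≫
    asIso (P.fromLeftDerivedZero' ((tensoringLeft (ModuleCat.{0} R)).obj M))

lemma homologyZeroIso_hom_naturality {M N : ModuleCat.{0} R} (f : M ⟶ N) {X : ModuleCat.{0} R}
    (P : ProjectiveResolution X) :
    HomologicalComplex.homologyMap (tensorComplexMap f P.complex) 0 ≫ (homologyZeroIso N P).hom =
      (homologyZeroIso M P).hom ≫ f ▷ X := by
  have h : HomologicalComplex.opcyclesMap (tensorComplexMap f P.complex) 0 ≫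
      P.fromLeftDerivedZero' ((tensoringLeft (ModuleCat.{0} R)).obj N) =
      P.fromLeftDerivedZero' ((tensoringLeft (ModuleCat.{0} R)).obj M) ≫ f ▷ X := by
    rw [← cancel_epi (HomologicalComplex.pOpcycles _ _),
      HomologicalComplex.p_opcyclesMap_assoc,
      ProjectiveResolution.pOpcycles_comp_fromLeftDerivedZero',
      ProjectiveResolution.pOpcycles_comp_fromLeftDerivedZero'_assoc]
    exact (((tensoringLeft (ModuleCat.{0} R)).map f).naturality (P.π.f 0)).symm
  simp only [homologyZeroIso, Iso.trans_hom, asIso_hom, Category.assoc,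
    ChainComplex.isoHomologyι₀, HomologicalComplex.isoHomologyι_hom]
  rw [← h, HomologicalComplex.homologyι_naturality_assoc]

lemma exists_connecting {S : ShortComplex (ModuleCat.{0} R)} (hS : S.ShortExact)
    [Module.Flat R S.X₂] {X : ModuleCat.{0} R} (P : ProjectiveResolution X) :
    ∃ (δ : (tensorComplex S.X₃ P.complex).homology 1 ⟶ (tensorComplex S.X₁ P.complex).homology 0)
      (h : δ ≫ HomologicalComplex.homologyMap (tensorComplexMap S.f P.complex) 0 = 0),
      Mono δ ∧ (ShortComplex.mk δ _ h).Exact :=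
  have hT := tensorShortComplex_shortExact hS P
  ⟨hT.δ 1 0 rfl, hT.δ_comp 1 0 rfl,
    hT.mono_δ 1 0 rfl (isZero_homology_succ_tensorComplex S.X₂ P 0), hT.homology_exact₁ 1 0 rfl⟩

/-- `Tor₁` of the last term of a short exact sequence with flat middle term is the kernel of the
first map tensored with `X`. -/
lemma nonempty_torOne_linearEquiv_ker {S : ShortComplex (ModuleCat.{0} R)} (hS : S.ShortExact)
    [Module.Flat R S.X₂] (X : ModuleCat.{0} R) :
    Nonempty (((Tor (ModuleCat.{0} R) 1).obj S.X₃).obj X ≃ₗ[R]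
      LinearMap.ker (LinearMap.rTensor X S.f.hom)) := by
  let P := projectiveResolution X
  obtain ⟨δ, h, hmono, hexact⟩ := exists_connecting hS P
  let d := (torIso S.X₃ X P 1).hom ≫ δ ≫ (homologyZeroIso S.X₁ P).hom
  have hd : Mono d := inferInstance
  have hzero : d ≫ S.f ▷ X = 0 := by
    simp only [d, Category.assoc, ← homologyZeroIso_hom_naturality]
    rw [reassoc_of% h]
    simp
  have hex : (ShortComplex.mk d (S.f ▷ X) hzero).Exact := by
    refine ShortComplex.exact_of_iso ?_ hexact
    exact ShortComplex.isoMk (torIso S.X₃ X P 1).symm (homologyZeroIso S.X₁ P)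
      (homologyZeroIso S.X₂ P) ((torIso S.X₃ X P 1).inv_hom_id_assoc _)
      (homologyZeroIso_hom_naturality S.f P).symm
  have h1 := (ShortComplex.ShortExact.moduleCat_exact_iff_function_exact _).1 hex
  have h2 := (ModuleCat.mono_iff_injective d).1 hd
  refine ⟨(LinearEquiv.ofInjective d.hom h2).trans (LinearEquiv.ofEq _ _ ?_)⟩
  ext x
  exact (h1 x).symm

end Tor

section Main
open TensorProduct Filter

variable {R : Type} [CommRing R]

/-- The kernel of the map on `L ⊗ N` induced by the quotient map modulo `J • N'` is `J` times the
image of `L ⊗ N'` in it. -/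
lemma ker_lTensor_mkQ_smul {N : Type} [AddCommGroup N] [Module R N] (L : Type) [AddCommGroup L]
    [Module R L] (J : Ideal R) (N' : Submodule R N) :
    LinearMap.ker (LinearMap.lTensor L (J • N').mkQ) =
      J • LinearMap.range (LinearMap.lTensor L N'.subtype) := by
  have h := lTensor_exact L (LinearMap.exact_subtype_mkQ (J • N')) (Submodule.mkQ_surjective _)
  rw [LinearMap.exact_iff] at h
  rw [h]
  apply le_antisymm
  · rintro _ ⟨z, rfl⟩
    induction z with
    | zero => simp
    | add x y hx hy => rw [map_add]; exact add_mem hx hy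
    | tmul l y =>
      have hle : J • N' ≤ (J • LinearMap.range (LinearMap.lTensor L N'.subtype)).comap
          (TensorProduct.mk R L N l) := by
        refine Submodule.smul_le.2 fun r hr n hn => ?_
        rw [Submodule.mem_comap, map_smul]
        exact Submodule.smul_mem_smul hr ⟨l ⊗ₜ ⟨n, hn⟩, rfl⟩
      exact hle y.2
  · refine Submodule.smul_le.2 ?_
    rintro r hr _ ⟨z, rfl⟩
    induction z with
    | zero => simp
    | add x y hx hy => rw [map_add, smul_add]; exact add_mem hx hy
    | tmul l y =>
      exact ⟨l ⊗ₜ ⟨r • (y : N), Submodule.smul_mem_smul hr y.2⟩, by simp⟩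

lemma mem_associatedPrimes_ker_rTensor_iff [IsNoetherianRing R] {K F N : Type} [AddCommGroup K]
    [Module R K] [AddCommGroup F] [Module R F] [AddCommGroup N] [Module R N] (g : K →ₗ[R] F)
    (J : Ideal R) (N' : Submodule R N) (p : Ideal R) :
    p ∈ associatedPrimes R (LinearMap.ker (LinearMap.rTensor (N ⧸ (J • N')) g)) ↔
      p.IsPrime ∧ ∃ u : K ⊗[R] N,
        LinearMap.rTensor N g u ∈ J • LinearMap.range (LinearMap.lTensor F N'.subtype) ∧
        ∀ r : R, r ∈ p ↔ r • u ∈ J • LinearMap.range (LinearMap.lTensor K N'.subtype) := by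
  have hcomm (u : K ⊗[R] N) : LinearMap.rTensor (N ⧸ (J • N')) g
      (LinearMap.lTensor K (J • N').mkQ u) =
      LinearMap.lTensor F (J • N').mkQ (LinearMap.rTensor N g u) := by
    rw [← LinearMap.comp_apply, ← LinearMap.comp_apply, LinearMap.rTensor_comp_lTensor,
      LinearMap.lTensor_comp_rTensor]
  rw [AssociatedPrimes.mem_iff, isAssociatedPrime_iff]
  refine and_congr_right fun _ => ?_
  simp only [← ker_lTensor_mkQ_smul, LinearMap.mem_ker, ← hcomm, map_smul]
  constructor
  · rintro ⟨⟨x, hx⟩, rfl⟩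
    obtain ⟨u, rfl⟩ := LinearMap.lTensor_surjective K (Submodule.mkQ_surjective (J • N')) x
    exact ⟨u, hx, fun r => by
      rw [Submodule.mem_colon_singleton, Submodule.mem_bot, Subtype.ext_iff]; rfl⟩
  · rintro ⟨u, hu, h⟩
    exact ⟨⟨_, hu⟩, Ideal.ext fun r => by
      rw [h, Submodule.mem_colon_singleton, Submodule.mem_bot, Subtype.ext_iff]; rfl⟩

variable {ι : Type} [Fintype ι] (I : ι → Ideal R)

/-- The associated primes of `ker (g ⊗ N / mpow I n • N')` are eventually constant. -/
lemma eventually_associatedPrimes_ker_rTensor [IsNoetherianRing R] {K F N : Type} [AddCommGroup K]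
    [Module R K] [Module.Finite R K] [AddCommGroup F] [Module R F] [Module.Finite R F]
    [AddCommGroup N] [Module R N] [Module.Finite R N] (g : K →ₗ[R] F) (N' : Submodule R N) :
    ∃ T : Set (Ideal R), ∀ᶠ n in atTop,
      associatedPrimes R (LinearMap.ker (LinearMap.rTensor (N ⧸ (mpow I n • N')) g)) = T := by
  obtain ⟨T, hT⟩ := eventually_forall_prime_colon_iff (I := I) (LinearMap.rTensor N g)
    (A' := LinearMap.range (LinearMap.lTensor K N'.subtype))
    (IsNoetherian.noetherian (LinearMap.range (LinearMap.lTensor F N'.subtype)))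
  exact ⟨T, hT.mono fun n hn => Set.ext fun p =>
    (mem_associatedPrimes_ker_rTensor_iff g _ N' p).trans (hn p)⟩

/-- A finite module is the cokernel in a short exact sequence of finite modules with free
middle term. -/
lemma exists_shortExact_free [IsNoetherianRing R] (M : Type) [AddCommGroup M] [Module R M]
    [Module.Finite R M] : ∃ (r : ℕ) (K : Submodule R (Fin r → R)) (π : (Fin r → R) →ₗ[R] M)
      (h : ModuleCat.ofHom K.subtype ≫ ModuleCat.ofHom π = 0),
      (ShortComplex.mk (ModuleCat.ofHom K.subtype) (ModuleCat.ofHom π) h).ShortExact := by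
  obtain ⟨r, π, hπ⟩ := Module.Finite.exists_fin' R M
  refine ⟨r, LinearMap.ker π, π, ?_, ?_⟩
  · ext x
    exact x.2
  · exact
      { exact := (ShortComplex.ShortExact.moduleCat_exact_iff_function_exact _).2
          (LinearMap.exact_subtype_ker_map π)
        mono_f := (ModuleCat.mono_iff_injective _).2 (Submodule.subtype_injective _)
        epi_g := (ModuleCat.epi_iff_surjective _).2 hπ }

/-- The associated primes of `Tor i M (N / mpow I n • N')` are eventually constant. -/
theorem eventually_associatedPrimes_tor [IsNoetherianRing R] {N : Type} [AddCommGroup N]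
    [Module R N] [Module.Finite R N] (N' : Submodule R N) (i : ℕ) (M : Type) [AddCommGroup M]
    [Module R M] [Module.Finite R M] :
    ∃ T : Set (Ideal R), ∀ᶠ n in atTop,
      associatedPrimes R (((Tor (ModuleCat.{0} R) i).obj (ModuleCat.of R M)).obj
        (ModuleCat.of R (N ⧸ (mpow I n • N')))) = T := by
  match i with
  | 0 =>
    obtain ⟨T, hT⟩ := eventually_associatedPrimes_ker_rTensor I (0 : M →ₗ[R] M) N'
    refine ⟨T, hT.mono fun n hn => ?_⟩
    rw [← hn]
    have e := (torZeroIso (ModuleCat.of R M)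
      (ModuleCat.of R (N ⧸ (mpow I n • N')))).toLinearEquiv
    have hker : LinearMap.ker (LinearMap.rTensor (N ⧸ (mpow I n • N')) (0 : M →ₗ[R] M)) = ⊤ := by
      rw [LinearMap.rTensor_zero, LinearMap.ker_zero]
    exact LinearEquiv.AssociatedPrimes.eq (e.trans (LinearEquiv.ofTop _ hker).symm)
  | 1 =>
    obtain ⟨r, K, π, h, hS⟩ := exists_shortExact_free (R := R) M
    obtain ⟨T, hT⟩ := eventually_associatedPrimes_ker_rTensor I K.subtype N'
    refine ⟨T, hT.mono fun n hn => ?_⟩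
    rw [← hn]
    have : Module.Flat R (ModuleCat.of R (Fin r → R)) :=
      inferInstanceAs (Module.Flat R (Fin r → R))
    obtain ⟨e⟩ := nonempty_torOne_linearEquiv_ker hS (ModuleCat.of R (N ⧸ (mpow I n • N')))
    exact LinearEquiv.AssociatedPrimes.eq e
  | i + 2 =>
    obtain ⟨r, K, π, h, hS⟩ := exists_shortExact_free (R := R) M
    obtain ⟨T, hT⟩ := eventually_associatedPrimes_tor N' (i + 1) K
    refine ⟨T, hT.mono fun n hn => ?_⟩
    rw [← hn]
    have : Module.Flat R (ModuleCat.of R (Fin r → R)) :=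
      inferInstanceAs (Module.Flat R (Fin r → R))
    exact LinearEquiv.AssociatedPrimes.eq
      (torSuccSuccIso hS (ModuleCat.of R (N ⧸ (mpow I n • N'))) i).toLinearEquiv

end Main

end KatzWest

/-- **Katz–West theorem (Tor).** For ideals `I₁,…,I_t` of a commutative Noetherian ring
`R`, finitely generated modules `M`, `N`, a submodule `N' ⊆ N` and fixed `i`, the set
of associated primes of `Tor_i^R(M, N/(I₁^{n₁}⋯I_t^{n_t})N')` is the same for all
`(n₁,…,n_t)` with all entries sufficiently large. -/
theorem katz_west_tor (R : Type) [CommRing R] [IsNoetherianRing R]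
    (t : ℕ) (I : Fin t → Ideal R) (M N : Type) [AddCommGroup M] [Module R M]
    [Module.Finite R M] [AddCommGroup N] [Module R N] [Module.Finite R N]
    (N' : Submodule R N) (i : ℕ) :
    ∃ k : ℕ, ∀ n m : Fin t → ℕ, (∀ j, k ≤ n j) → (∀ j, k ≤ m j) →
      associatedPrimes R
        (((Tor (ModuleCat R) i).obj (ModuleCat.of R M)).obj
          (ModuleCat.of R (N ⧸ ((∏ j, I j ^ n j) • N')))) =
      associatedPrimes R
        (((Tor (ModuleCat R) i).obj (ModuleCat.of R M)).obj
          (ModuleCat.of R (N ⧸ ((∏ j, I j ^ m j) • N')))) := by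
  obtain ⟨T, hT⟩ := KatzWest.eventually_associatedPrimes_tor I N' i M
  obtain ⟨n₀, h₀⟩ := Filter.eventually_atTop.1 hT
  have key (n : Fin t → ℕ) (hn : ∀ j, Finset.univ.sup n₀ ≤ n j) :=
    h₀ (Finsupp.equivFunOnFinite.symm n) fun j =>
      (Finset.le_sup (f := n₀) (Finset.mem_univ j)).trans (hn j)
  exact ⟨Finset.univ.sup n₀, fun n m hn hm => (key n hn).trans (key m hm).symm⟩
end

section
/- Let R be a commutative Noetherian ring, I_1,...,I_t ideals, M and N finitely generated R-modules, N' ⊆ N a submodule, and fix i ≥ 0. Then the union over all (n_1,...,n_t) ∈ ℕ^t of the sets Ass_R(Ext_R^i(M, N/(I_1^{n_1}⋯I_t^{n_t}) N')) is a finite set. -/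
open CategoryTheory

/-- For submodules `X` and `Y` of a module over a Noetherian ring, the associated primes of
`(X + Y) / Y`: the prime ideals of the form `(Y : x)` with `x ∈ X`. -/
def relAssociatedPrimes {R B : Type*} [CommRing R] [AddCommGroup B] [Module R B]
    (X Y : Submodule R B) : Set (Ideal R) :=
  {p | p.IsPrime ∧ ∃ x ∈ X, ∀ r, r ∈ p ↔ r • x ∈ Y}

section RelAssociatedPrimes

variable {R B : Type*} [CommRing R] [AddCommGroup B] [Module R B]

theorem relAssociatedPrimes_subset_union (X : Submodule R B) {Y Z : Submodule R B} (h : Y ≤ Z) :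
    relAssociatedPrimes X Y ⊆ relAssociatedPrimes X Z ∪ relAssociatedPrimes Z Y := by
  rintro p ⟨hp, x, hx, hpx⟩
  by_cases ha : ∃ a, a ∉ p ∧ a • x ∈ Z
  · obtain ⟨a, hap, haz⟩ := ha
    refine Or.inr ⟨hp, a • x, haz, fun r => ?_⟩
    rw [smul_smul, ← hpx]
    exact ⟨fun hr => p.mul_mem_right _ hr, fun hr => (hp.mem_or_mem hr).resolve_right hap⟩
  · push Not at ha
    exact Or.inl ⟨hp, x, hx, fun r =>
      ⟨fun hr => h ((hpx r).1 hr), fun hr => by_contra fun hrp => ha r hrp hr⟩⟩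

theorem relAssociatedPrimes_sup_subset (X : Submodule R B) {F Y : Submodule R B} (h : F ≤ Y) :
    relAssociatedPrimes (F ⊔ X) Y ⊆ relAssociatedPrimes X Y := by
  rintro p ⟨hp, x, hx, hpx⟩
  obtain ⟨f, hf, y, hy, rfl⟩ := Submodule.mem_sup.1 hx
  refine ⟨hp, y, hy, fun r => ?_⟩
  rw [hpx, smul_add, Submodule.add_mem_iff_right _ (Y.smul_mem r (h hf))]

theorem relAssociatedPrimes_top_finite [IsNoetherianRing R] [Module.Finite R B]
    (Y : Submodule R B) : (relAssociatedPrimes ⊤ Y).Finite := by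
  refine (associatedPrimes.finite R (B ⧸ Y)).subset ?_
  rintro p ⟨hp, x, -, hpx⟩
  refine isAssociatedPrime_iff.2 ⟨hp, Y.mkQ x, ?_⟩
  ext r
  rw [hpx, Submodule.mem_colon_singleton, ← map_smul, Submodule.mem_bot, Submodule.mkQ_apply,
    Submodule.Quotient.mk_eq_zero]

end RelAssociatedPrimes

/-- A finitely generated module over a Noetherian `R`-algebra has only finitely many primes of `R`
that are annihilators of elements. -/
theorem finite_primes_annihilator_of_algebra (R : Type*) {S E : Type*} [CommRing R] [CommRing S]
    [Algebra R S] [IsNoetherianRing S] [AddCommGroup E] [Module S E] [hE : Module.Finite S E] :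
    {p : Ideal R | p.IsPrime ∧ ∃ x : E, ∀ r, r ∈ p ↔ algebraMap R S r • x = 0}.Finite := by
  induction hE using IsNoetherianRing.induction_on_isQuotientEquivQuotientPrime S with
  | subsingleton N =>
    refine Set.finite_empty.subset ?_
    rintro p ⟨hp, x, hpx⟩
    exact hp.ne_top (p.eq_top_iff_one.2 ((hpx 1).2 (Subsingleton.elim _ _)))
  | quotient N q f =>
    refine (Set.finite_singleton (q.1.comap (algebraMap R S))).subset ?_
    rintro p ⟨hp, x, hpx⟩
    have hx : f x ≠ 0 := fun h => hp.ne_top (p.eq_top_iff_one.2 ((hpx 1).2 (by simpa using h)))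
    have := q.2
    refine Ideal.ext fun r => ?_
    rw [hpx, ← f.map_eq_zero_iff, map_smul, Algebra.smul_def, mul_eq_zero, or_iff_left hx,
      Ideal.Quotient.algebraMap_eq, Ideal.Quotient.eq_zero_iff_mem, Ideal.mem_comap]
  | exact N₁ N₂ N₃ f g hf _ hfg h₁ h₃ =>
    refine (h₁.union h₃).subset ?_
    rintro p ⟨hp, x, hpx⟩
    by_cases ha : ∃ a, a ∉ p ∧ algebraMap R S a • g x = 0
    · obtain ⟨a, hap, haz⟩ := ha
      rw [← map_smul] at haz
      obtain ⟨y, hy⟩ := (hfg _).1 haz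
      refine Or.inl ⟨hp, y, fun r => ?_⟩
      rw [← map_eq_zero_iff f hf, map_smul, hy, smul_smul, ← map_mul, ← hpx]
      exact ⟨fun hr => p.mul_mem_right _ hr, fun hr => (hp.mem_or_mem hr).resolve_right hap⟩
    · push Not at ha
      refine Or.inr ⟨hp, g x, fun r => ⟨fun hr => ?_, fun hr => by_contra fun hrp => ha r hrp hr⟩⟩
      rw [← map_smul, (hpx r).1 hr, map_zero]

theorem finite_primes_colon_of_algebra (R : Type*) {S E : Type*} [CommRing R] [CommRing S]
    [Algebra R S] [IsNoetherianRing S] [AddCommGroup E] [Module S E] [Module.Finite S E]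
    (Y : Submodule S E) :
    {p : Ideal R | p.IsPrime ∧ ∃ x, ∀ r, r ∈ p ↔ algebraMap R S r • x ∈ Y}.Finite := by
  refine (finite_primes_annihilator_of_algebra R (S := S) (E := E ⧸ Y)).subset ?_
  rintro p ⟨hp, x, hpx⟩
  refine ⟨hp, Y.mkQ x, fun r => ?_⟩
  rw [hpx, ← map_smul, Submodule.mkQ_apply, Submodule.Quotient.mk_eq_zero]

section MultiRees

open MvPolynomial

variable {R σ : Type*} [CommRing R]

/-- The ideal of elements `a` such that `a * X ^ k` lies in the subalgebra `A`. -/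
noncomputable def monomialCoeffIdeal (A : Subalgebra R (MvPolynomial σ R)) (k : σ →₀ ℕ) : Ideal R :=
  A.toSubmodule.comap (monomial k)

theorem mem_monomialCoeffIdeal {A : Subalgebra R (MvPolynomial σ R)} {k : σ →₀ ℕ} {a : R} :
    a ∈ monomialCoeffIdeal A k ↔ monomial k a ∈ A := Iff.rfl

theorem monomialCoeffIdeal_zero (A : Subalgebra R (MvPolynomial σ R)) :
    monomialCoeffIdeal A 0 = ⊤ :=
  (Ideal.eq_top_iff_one _).2 A.one_mem

theorem monomialCoeffIdeal_mul_le (A : Subalgebra R (MvPolynomial σ R)) (k l : σ →₀ ℕ) :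
    monomialCoeffIdeal A k * monomialCoeffIdeal A l ≤ monomialCoeffIdeal A (k + l) := by
  refine Ideal.mul_le.2 fun a ha b hb => ?_
  rw [mem_monomialCoeffIdeal, ← monomial_mul]
  exact A.mul_mem ha hb

variable [Fintype σ] (I : σ → Ideal R)

/-- The product `∏ j, I j ^ k j` of powers of a finite family of ideals. -/
def idealPow (k : σ →₀ ℕ) : Ideal R := ∏ j, I j ^ k j

theorem idealPow_zero : idealPow I 0 = 1 := by simp [idealPow]

theorem idealPow_add (k l : σ →₀ ℕ) : idealPow I (k + l) = idealPow I k * idealPow I l := by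
  simp [idealPow, pow_add, Finset.prod_mul_distrib]

/-- The multi-Rees algebra `R[I j * X j]` of a finite family of ideals. -/
noncomputable def multiReesAlgebra : Subalgebra R (MvPolynomial σ R) where
  carrier := {p | ∀ k, coeff k p ∈ idealPow I k}
  mul_mem' {p q} hp hq k := by
    classical
    rw [coeff_mul]
    refine Ideal.sum_mem _ fun x hx => ?_
    rw [← Finset.HasAntidiagonal.mem_antidiagonal.1 hx, idealPow_add]
    exact Ideal.mul_mem_mul (hp _) (hq _)
  add_mem' hp hq k := by
    rw [coeff_add]
    exact Ideal.add_mem _ (hp k) (hq k)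
  algebraMap_mem' r k := by
    classical
    rw [algebraMap_eq, coeff_C]
    split_ifs with h
    · subst h
      simp [idealPow_zero]
    · exact Ideal.zero_mem _

variable {I} in
theorem monomial_mem_multiReesAlgebra {k : σ →₀ ℕ} {a : R} (ha : a ∈ idealPow I k) :
    monomial k a ∈ multiReesAlgebra I := by
  classical
  intro l
  rw [coeff_monomial]
  split_ifs with h
  · exact h ▸ ha
  · exact Ideal.zero_mem _

theorem idealPow_le_monomialCoeffIdeal (A : Subalgebra R (MvPolynomial σ R))
    (hA : ∀ j, I j ≤ monomialCoeffIdeal A (Finsupp.single j 1)) (k : σ →₀ ℕ) :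
    idealPow I k ≤ monomialCoeffIdeal A k := by
  classical
  have hpow (j : σ) (n : ℕ) : I j ^ n ≤ monomialCoeffIdeal A (Finsupp.single j n) := by
    induction n with
    | zero => simp [monomialCoeffIdeal_zero]
    | succ n ih =>
      rw [pow_succ, Finsupp.single_add]
      exact (Ideal.mul_mono ih (hA j)).trans (monomialCoeffIdeal_mul_le _ _ _)
  have hprod (s : Finset σ) :
      ∏ j ∈ s, I j ^ k j ≤ monomialCoeffIdeal A (∑ j ∈ s, Finsupp.single j (k j)) := by
    induction s using Finset.induction_on with
    | empty => simp [monomialCoeffIdeal_zero]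
    | insert j s hj ih =>
      rw [Finset.prod_insert hj, Finset.sum_insert hj]
      exact (Ideal.mul_mono (hpow j _) ih).trans (monomialCoeffIdeal_mul_le _ _ _)
  simpa [idealPow, Finsupp.univ_sum_single] using hprod Finset.univ

theorem multiReesAlgebra_fg [IsNoetherianRing R] : (multiReesAlgebra I).FG := by
  classical
  choose G hG using fun j => (IsNoetherian.noetherian (I j) : (I j).FG)
  set s : Finset (MvPolynomial σ R) :=
    Finset.univ.biUnion fun j => (G j).image (monomial (Finsupp.single j 1)) with hs
  have hmem (j : σ) {g : R} (hg : g ∈ G j) : monomial (Finsupp.single j 1) g ∈ s :=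
    Finset.mem_biUnion.2 ⟨j, Finset.mem_univ j, Finset.mem_image_of_mem _ hg⟩
  refine ⟨s, le_antisymm (Algebra.adjoin_le fun p hp => ?_) fun p hp => ?_⟩
  · obtain ⟨j, -, hj⟩ := Finset.mem_biUnion.1 (Finset.mem_coe.1 hp)
    obtain ⟨g, hg, rfl⟩ := Finset.mem_image.1 hj
    refine monomial_mem_multiReesAlgebra ?_
    have : idealPow I (Finsupp.single j 1) = I j := by
      rw [idealPow, Finset.prod_eq_single j] <;> simp +contextual [eq_comm]
    rw [this, ← hG j]
    exact Submodule.subset_span hg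
  · rw [p.as_sum]
    refine Subalgebra.sum_mem _ fun k _ => ?_
    refine mem_monomialCoeffIdeal.1 (idealPow_le_monomialCoeffIdeal I _ (fun j => ?_) k (hp k))
    rw [← hG j]
    exact Submodule.span_le.2 fun g hg => Algebra.subset_adjoin (hmem j hg)

instance [IsNoetherianRing R] : IsNoetherianRing (multiReesAlgebra I) :=
  isNoetherianRing_of_fg (multiReesAlgebra_fg I)

/-- A uniform finiteness result: if the submodules `Y n` form a graded module over the
multi-Rees algebra, then the modules `(I ^ n B' + Y n) / Y n` have, all together, only finitely
many associated primes. -/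
theorem finite_iUnion_relAssociatedPrimes_idealPow_smul [IsNoetherianRing R]
    {B : Type*} [AddCommGroup B] [Module R B] {B' : Submodule R B} (hB' : B'.FG)
    (Y : (σ →₀ ℕ) → Submodule R B) (hY : ∀ k n, idealPow I k • Y n ≤ Y (k + n)) :
    (⋃ n, relAssociatedPrimes (idealPow I n • B') (Y n)).Finite := by
  classical
  obtain ⟨m, b, rfl⟩ := Submodule.fg_iff_exists_fin_generating_family.1 hB'
  let S := multiReesAlgebra I
  let c (n : σ →₀ ℕ) (v : Fin m → S) : B := ∑ i, coeff n (v i : MvPolynomial σ R) • b i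
  have c_smul (n) (s : S) (v) :
      c n (s • v) = ∑ x ∈ Finset.HasAntidiagonal.antidiagonal n, coeff x.1 (s : MvPolynomial σ R) • c x.2 v := by
    simp only [c, Pi.smul_apply, smul_eq_mul, MulMemClass.coe_mul, coeff_mul, Finset.sum_smul,
      Finset.smul_sum, smul_smul]
    exact Finset.sum_comm
  let 𝒴 : Submodule S (Fin m → S) :=
    { carrier := {v | ∀ n, c n v ∈ Y n}
      add_mem' := fun {v w} hv hw n => by
        have : c n (v + w) = c n v + c n w := by simp [c, add_smul, Finset.sum_add_distrib]
        rw [this]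
        exact (Y n).add_mem (hv n) (hw n)
      zero_mem' := fun n => by simp [c]
      smul_mem' := fun s v hv n => by
        rw [c_smul]
        refine Submodule.sum_mem _ fun x hx => ?_
        rw [← Finset.HasAntidiagonal.mem_antidiagonal.1 hx]
        exact hY _ _ (Submodule.smul_mem_smul (s.2 _) (hv _)) }
  refine (finite_primes_colon_of_algebra R 𝒴).subset ?_
  refine Set.iUnion_subset fun n => ?_
  rintro p ⟨hp, x, hx, hpx⟩
  obtain ⟨a, ha, rfl⟩ := (Submodule.mem_ideal_smul_span_iff_exists_sum _ _ _).1 hx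
  let v : Fin m → S := fun i => ⟨monomial n (a i), monomial_mem_multiReesAlgebra (ha i)⟩
  refine ⟨hp, v, fun r => ?_⟩
  have hc (k) : c k (algebraMap R S r • v) =
      if n = k then r • a.sum fun i c => c • b i else 0 := by
    split_ifs with h
    · subst h
      simp [c, v, Finsupp.sum_fintype, Finset.smul_sum, smul_smul]
    · simp [c, v, coeff_monomial, h]
  rw [hpx]
  refine ⟨fun hr k => ?_, fun h => by simpa only [hc, if_pos] using h n⟩
  rw [hc]
  split_ifs with h
  · exact h ▸ hr
  · exact (Y k).zero_mem

/-- As `n` varies, the modules `B / (F + I ^ n B')` have, all together, only finitely many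
associated primes. -/
theorem finite_iUnion_relAssociatedPrimes_top [IsNoetherianRing R]
    {B : Type*} [AddCommGroup B] [Module R B] [Module.Finite R B] (F B' : Submodule R B) :
    (⋃ n, relAssociatedPrimes ⊤ (F ⊔ idealPow I n • B')).Finite := by
  classical
  have hfin (j : σ) := finite_iUnion_relAssociatedPrimes_idealPow_smul I
    (IsNoetherian.noetherian B')
    (fun n => F ⊔ idealPow I (n + Finsupp.single j 1) • B') (fun k n => by
      rw [Submodule.smul_sup, ← Submodule.mul_smul, ← idealPow_add, add_assoc]
      exact sup_le_sup_right Submodule.smul_le_right _)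
  refine ((Set.finite_iUnion hfin).union (relAssociatedPrimes_top_finite (F ⊔ B'))).subset ?_
  refine Set.iUnion_subset fun n => ?_
  induction n using WellFoundedLT.induction with
  | ind n ih =>
    by_cases hn : n = 0
    · rw [hn, idealPow_zero, one_smul]
      exact Set.subset_union_right
    · obtain ⟨j, hj⟩ := Finsupp.ne_iff.1 hn
      obtain ⟨m, rfl⟩ : ∃ m, n = m + Finsupp.single j 1 :=
        ⟨n - Finsupp.single j 1, (tsub_add_cancel_of_le
          (Finsupp.single_le_iff.2 (Nat.one_le_iff_ne_zero.2 hj))).symm⟩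
      have hlt : m < m + Finsupp.single j 1 := lt_add_of_pos_right _ (by simp [pos_iff_ne_zero])
      have hle : F ⊔ idealPow I (m + Finsupp.single j 1) • B' ≤ F ⊔ idealPow I m • B' := by
        rw [idealPow_add]
        exact sup_le_sup_left (Submodule.smul_mono_left Ideal.mul_le_left) _
      refine (relAssociatedPrimes_subset_union ⊤ hle).trans (Set.union_subset (ih m hlt) ?_)
      refine (relAssociatedPrimes_sup_subset _ le_sup_left).trans ?_
      exact fun p hp => Or.inl (Set.mem_iUnion.2 ⟨j, Set.mem_iUnion.2 ⟨m, hp⟩⟩)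

end MultiRees

section FreeResolution

universe u

variable {R : Type u} [CommRing R] [IsNoetherianRing R]

theorem exists_linearMap_range_eq {r : ℕ} (K : Submodule R (Fin r → R)) :
    ∃ (s : ℕ) (f : (Fin s → R) →ₗ[R] (Fin r → R)), LinearMap.range f = K := by
  obtain ⟨s, f, hf⟩ := Module.Finite.exists_fin' R K
  exact ⟨s, K.subtype ∘ₗ f, by
    rw [LinearMap.range_comp, LinearMap.range_eq_top.2 hf, Submodule.map_top, K.range_subtype]⟩

/-- Over a Noetherian ring, every finitely generated module has a resolution by finitely generated
free modules. -/
theorem exists_projectiveResolution_free_finite (M : Type u) [AddCommGroup M] [Module R M]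
    [Module.Finite R M] : ∃ P : ProjectiveResolution (ModuleCat.of R M),
      ∀ n, Module.Free R (P.complex.X n) ∧ Module.Finite R (P.complex.X n) := by
  choose rk cover range_cover using fun (s : Σ r : ℕ, Submodule R (Fin r → R)) =>
    exists_linearMap_range_eq s.2
  obtain ⟨r₀, ε, hε⟩ := Module.Finite.exists_fin' R M
  let s : ℕ → Σ r : ℕ, Submodule R (Fin r → R) := fun n =>
    Nat.rec ⟨r₀, LinearMap.ker ε⟩ (fun _ s => ⟨rk s, LinearMap.ker (cover s)⟩) n
  let X (n : ℕ) : ModuleCat.{u} R := ModuleCat.of R (Fin (s n).1 → R)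
  let d (n : ℕ) : X (n + 1) ⟶ X n := ModuleCat.ofHom (cover (s n))
  have exact_d (n : ℕ) : Function.Exact (cover (s (n + 1))) (cover (s n)) :=
    LinearMap.exact_iff.2 (range_cover (s (n + 1))).symm
  have exact_ε : Function.Exact (cover (s 0)) ε := LinearMap.exact_iff.2 (range_cover (s 0)).symm
  have hd (n : ℕ) : d (n + 1) ≫ d n = 0 := ModuleCat.hom_ext (exact_d n).linearMap_comp_eq_zero
  let C : ChainComplex (ModuleCat.{u} R) ℕ := ChainComplex.of X d hd
  have hC (n : ℕ) : C.d (n + 1) n = d n := ChainComplex.of_d X d n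
  have hε0 : C.d 1 0 ≫ (ModuleCat.ofHom ε : X 0 ⟶ ModuleCat.of R M) = 0 := by
    rw [hC]
    exact ModuleCat.hom_ext exact_ε.linearMap_comp_eq_zero
  refine ⟨{ complex := C
            projective := fun n => ?_
            π := (ChainComplex.toSingle₀Equiv _ _).symm ⟨ModuleCat.ofHom ε, hε0⟩
            quasiIso := ⟨fun n => ?_⟩ }, fun n => ⟨?_, ?_⟩⟩
  · change Projective (X n)
    infer_instance
  · cases n with
    | zero =>
      rw [ChainComplex.quasiIsoAt₀_iff, ShortComplex.quasiIso_iff_of_zeros']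
      · refine (ShortComplex.exact_and_epi_g_iff_of_iso
          (S₂ := ShortComplex.mk (d 0) (ModuleCat.ofHom ε : X 0 ⟶ ModuleCat.of R M)
            (ModuleCat.hom_ext exact_ε.linearMap_comp_eq_zero)) ?_).2
          ⟨(ShortComplex.ShortExact.moduleCat_exact_iff_function_exact _).2 exact_ε,
            (ModuleCat.epi_iff_surjective _).2 hε⟩
        exact ShortComplex.isoMk (Iso.refl _) (Iso.refl _) (Iso.refl _)
          (((Category.id_comp _).trans (hC 0).symm).trans (Category.comp_id _).symm)
          ((Category.id_comp _).trans (Category.comp_id _).symm)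
      all_goals rfl
    | succ n =>
      rw [quasiIsoAt_iff_exactAt']
      · rw [HomologicalComplex.exactAt_iff' _ (n + 1 + 1) (n + 1) n (by simp) (by simp)]
        refine (ShortComplex.ShortExact.moduleCat_exact_iff_function_exact _).2 ?_
        change Function.Exact (C.d (n + 1 + 1) (n + 1)) (C.d (n + 1) n)
        rw [hC, hC]
        exact exact_d n
      · apply ChainComplex.exactAt_succ_single_obj
  · change Module.Free R (Fin (s n).1 → R)
    infer_instance
  · change Module.Finite R (Fin (s n).1 → R)
    infer_instance

end FreeResolution

section Presentation

variable {R : Type*} [CommRing R] [IsNoetherianRing R]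

/-- As `n` varies, the cokernels of `Hom(X', N / I ^ n N') → Hom(X, N / I ^ n N')` have, all together,
only finitely many associated primes. -/
theorem finite_primes_colon_range_lcomp {σ : Type*} [Fintype σ] (I : σ → Ideal R)
    {X X' N : Type*} [AddCommGroup X] [Module R X] [Module.Free R X] [Module.Finite R X]
    [AddCommGroup X'] [Module R X'] [Module.Projective R X']
    [AddCommGroup N] [Module R N] [Module.Finite R N] (N' : Submodule R N) (d : X →ₗ[R] X') :
    {p : Ideal R | p.IsPrime ∧ ∃ (n : σ →₀ ℕ) (y : X →ₗ[R] N ⧸ (idealPow I n • N')),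
      ∀ r, r ∈ p ↔ ∃ w, r • y = w ∘ₗ d}.Finite := by
  let F : Submodule R (X →ₗ[R] N) := LinearMap.range (LinearMap.lcomp R N d)
  let B' : Submodule R (X →ₗ[R] N) :=
    { carrier := {φ | ∀ x, φ x ∈ N'}
      add_mem' := fun hφ hψ x => N'.add_mem (hφ x) (hψ x)
      zero_mem' := fun _ => N'.zero_mem
      smul_mem' := fun r _ hφ x => N'.smul_mem r (hφ x) }
  have mem_smul (J : Ideal R) (φ : X →ₗ[R] N) : φ ∈ J • B' ↔ ∀ x, φ x ∈ J • N' := by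
    constructor
    · intro hφ x
      have : (J • B').map (LinearMap.applyₗ x) ≤ J • N' := by
        rw [Submodule.map_smul'']
        refine smul_mono_right _ (Submodule.map_le_iff_le_comap.2 fun ψ hψ => hψ x)
      exact this (Submodule.mem_map_of_mem hφ)
    · intro hφ
      let b := Module.Free.chooseBasis R X
      have hsum : φ = ∑ k, (b.coord k).smulRight (φ (b k)) := by
        refine b.ext fun i => ?_
        simp [Finsupp.single_apply]
      rw [hsum]
      refine Submodule.sum_mem _ fun k _ => ?_
      have : (J • N').map (LinearMap.smulRightₗ (b.coord k)) ≤ J • B' := by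
        rw [Submodule.map_smul'']
        refine smul_mono_right _ (Submodule.map_le_iff_le_comap.2 fun z hz x => ?_)
        exact N'.smul_mem _ hz
      exact this (Submodule.mem_map_of_mem (hφ (b k)))
  refine (finite_iUnion_relAssociatedPrimes_top I F B').subset ?_
  rintro p ⟨hp, n, y, hpy⟩
  obtain ⟨z, hz⟩ := Module.projective_lifting_property (idealPow I n • N').mkQ y
    (Submodule.mkQ_surjective _)
  refine Set.mem_iUnion.2 ⟨n, hp, z, trivial, fun r => ?_⟩
  rw [hpy, ← hz, Submodule.mem_sup]
  constructor
  · rintro ⟨w, hw⟩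
    obtain ⟨w', rfl⟩ := Module.projective_lifting_property (idealPow I n • N').mkQ w
      (Submodule.mkQ_surjective _)
    refine ⟨w' ∘ₗ d, ⟨w', rfl⟩, r • z - w' ∘ₗ d, (mem_smul _ _).2 fun x => ?_, by abel⟩
    rw [← Submodule.Quotient.mk_eq_zero]
    have := LinearMap.congr_fun hw x
    simpa [sub_eq_zero] using this
  · rintro ⟨_, ⟨w', rfl⟩, φ, hφ, h⟩
    refine ⟨(idealPow I n • N').mkQ ∘ₗ w', LinearMap.ext fun x => ?_⟩
    have h1 := congrArg (idealPow I n • N').mkQ (LinearMap.congr_fun h x)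
    have h2 := (Submodule.Quotient.mk_eq_zero _).2 ((mem_smul _ _).1 hφ x)
    simpa [h2] using h1.symm

end Presentation

/-- The union over all `(n₁,…,n_t) ∈ ℕᵗ` of the sets of associated primes of
`Ext_R^i(M, N/(I₁^{n₁}⋯I_t^{n_t})N')` is finite. -/
theorem finite_union_ass_ext (R : Type) [CommRing R] [IsNoetherianRing R]
    (t : ℕ) (I : Fin t → Ideal R) (M N : Type) [AddCommGroup M] [Module R M]
    [Module.Finite R M] [AddCommGroup N] [Module R N] [Module.Finite R N]
    (N' : Submodule R N) (i : ℕ) :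
    (⋃ n : Fin t → ℕ,
      associatedPrimes R
        (((Ext R (ModuleCat R) i).obj (Opposite.op (ModuleCat.of R M))).obj
          (ModuleCat.of R (N ⧸ ((∏ j, I j ^ n j) • N'))))).Finite := by
  obtain ⟨P, hP⟩ := exists_projectiveResolution_free_finite (R := R) M
  have := (hP i).1
  have := (hP i).2
  let j := (ComplexShape.up ℕ).prev i
  have := (hP j).1
  refine (finite_primes_colon_range_lcomp I N' (P.complex.d i j).hom).subset ?_
  refine Set.iUnion_subset fun n p hp => ?_
  let Q := ModuleCat.of R (N ⧸ ((∏ j, I j ^ n j) • N'))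
  let K := P.complex.linearYonedaObj R Q
  have hp' := (LinearEquiv.isAssociatedPrime_iff (P.isoExt i Q).toLinearEquiv).1 hp
  have hp'' := hp'.map_of_injective (K.homologyι i).hom
    ((ModuleCat.mono_iff_injective _).1 inferInstance)
  obtain ⟨hpp, y, hy⟩ := isAssociatedPrime_iff.1 hp''
  obtain ⟨y, rfl⟩ := (ModuleCat.epi_iff_surjective (K.pOpcycles i)).1 inferInstance y
  have hex : (ShortComplex.mk (K.d j i) (K.pOpcycles i) (by simp)).Exact :=
    ShortComplex.exact_of_g_is_cokernel _ (K.opcyclesIsCokernel j i rfl)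
  rw [ShortComplex.ShortExact.moduleCat_exact_iff_function_exact] at hex
  refine ⟨hpp, Finsupp.equivFunOnFinite.symm n, y.hom, fun r => ?_⟩
  rw [hy, Submodule.mem_colon_singleton, Submodule.mem_bot, ← map_smul]
  refine (hex _).trans ⟨?_, ?_⟩
  · rintro ⟨w, hw⟩
    exact ⟨w.hom, (congrArg ModuleCat.Hom.hom hw).symm⟩
  · rintro ⟨w, hw⟩
    exact ⟨ModuleCat.ofHom w, ModuleCat.hom_ext hw.symm⟩
end
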